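/- arXiv:1103.1034 — 3 statements merged into one kernel-verified Lean document; each statement's English description precedes it below -/
import Mathlib

section
/- Let f belong to W¹[−1,1] with constant M₁. Then for every x ∈ (−1,1) the Cauchy principal value R_N(f,x) = J(f − S_N, x) exists and satisfies |R_N(f,x)| ≤ (4γM₁/π)·(1 + π√2/(2γ·ln N))·(ln N)/N. -/
open Real MeasureTheory Filter Topology

/-- An antiderivative in `u` of `√(1 - x²) / (√(1 - u²) (u - x))`. -/
noncomputable def cauchyPrimitive (x u : ℝ) : ℝ :=
  log (u - x) - log (1 - x * u + √(1 - x ^ 2) * √(1 - u ^ 2))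

lemma one_sub_mul_pos {x u : ℝ} (hx : x ∈ Set.Ioo (-1 : ℝ) 1) (hu : u ∈ Set.Icc (-1 : ℝ) 1) :
    0 < 1 - x * u := by
  obtain ⟨h1, h2⟩ := hx
  obtain ⟨h3, h4⟩ := hu
  rcases le_total x 0 with h | h
  · nlinarith [mul_nonneg (neg_nonneg.2 h) (by linarith : 0 ≤ 1 + u)]
  · nlinarith [mul_nonneg h (by linarith : 0 ≤ 1 - u)]

lemma cauchyPrimitive_denom_pos {x u : ℝ} (hx : x ∈ Set.Ioo (-1 : ℝ) 1)
    (hu : u ∈ Set.Icc (-1 : ℝ) 1) : 0 < 1 - x * u + √(1 - x ^ 2) * √(1 - u ^ 2) :=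
  add_pos_of_pos_of_nonneg (one_sub_mul_pos hx hu) (by positivity)

lemma cauchyPrimitive_one (x : ℝ) : cauchyPrimitive x 1 = 0 := by
  simp [cauchyPrimitive]

lemma cauchyPrimitive_neg_one (x : ℝ) : cauchyPrimitive x (-1) = 0 := by
  have h : -1 - x = -(1 + x) := by ring
  simp only [cauchyPrimitive, h, log_neg_eq_log]
  norm_num

lemma cauchyPrimitive_neg_neg (x u : ℝ) :
    cauchyPrimitive (-x) (-u) = cauchyPrimitive x u := by
  have h : -u - -x = -(u - x) := by ring
  simp only [cauchyPrimitive, h, log_neg_eq_log, neg_mul_neg, neg_sq]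

lemma hasDerivAt_cauchyPrimitive {x u : ℝ} (hx : x ∈ Set.Ioo (-1 : ℝ) 1)
    (hu : u ∈ Set.Ioo (-1 : ℝ) 1) (hux : u ≠ x) :
    HasDerivAt (cauchyPrimitive x) (√(1 - x ^ 2) * (1 / (√(1 - u ^ 2) * (u - x)))) u := by
  have hD := cauchyPrimitive_denom_pos hx (Set.Ioo_subset_Icc_self hu)
  have hr : 0 < 1 - u ^ 2 := by nlinarith [hu.1, hu.2]
  have hs : 0 < 1 - x ^ 2 := by nlinarith [hx.1, hx.2]
  have hux' : u - x ≠ 0 := sub_ne_zero.2 hux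
  have h1 : HasDerivAt (fun u : ℝ => u - x) 1 u := (hasDerivAt_id u).sub_const x
  have h2 : HasDerivAt (fun u : ℝ => 1 - u ^ 2) (-(2 * u)) u := by
    simpa using (hasDerivAt_pow 2 u).const_sub 1
  have h3 := h2.sqrt hr.ne'
  have h4 : HasDerivAt (fun u : ℝ => 1 - x * u) (-x) u := by
    simpa using ((hasDerivAt_id u).const_mul x).const_sub 1
  have h5 := (h1.log hux').sub ((h4.add (h3.const_mul (√(1 - x ^ 2)))).log hD.ne')
  refine h5.congr_deriv ?_
  have hr' : 0 < √(1 - u ^ 2) := sqrt_pos.2 hr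
  have er := sq_sqrt hr.le
  have es := sq_sqrt hs.le
  change 1 / (u - x) - (-x + √(1 - x ^ 2) * (-(2 * u) / (2 * √(1 - u ^ 2)))) /
    (1 - x * u + √(1 - x ^ 2) * √(1 - u ^ 2)) = _
  generalize √(1 - u ^ 2) = r at *
  generalize √(1 - x ^ 2) = s at *
  generalize hDeq : 1 - x * u + s * r = D at *
  field_simp
  linear_combination s * er - r * es - (r - s) * hDeq

lemma continuousOn_cauchyPrimitive {x : ℝ} (hx : x ∈ Set.Ioo (-1 : ℝ) 1) :
    ContinuousOn (cauchyPrimitive x) (Set.Icc (-1) 1 \ {x}) := by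
  unfold cauchyPrimitive
  refine ContinuousOn.sub (ContinuousOn.log (by fun_prop) ?_) (ContinuousOn.log (by fun_prop) ?_)
  · exact fun u hu => sub_ne_zero.2 hu.2
  · exact fun u hu => (cauchyPrimitive_denom_pos hx hu.1).ne'

lemma intervalIntegrable_inv_sqrt_one_sub_sq :
    IntervalIntegrable (fun u : ℝ => 1 / √(1 - u ^ 2)) volume (-1) 1 := by
  refine intervalIntegral.intervalIntegrable_deriv_of_nonneg (g := arcsin)
    continuous_arcsin.continuousOn ?_ ?_
  · intro u hu
    norm_num at hu
    exact hasDerivAt_arcsin hu.1.ne' hu.2.ne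
  · intro u _
    positivity

lemma integral_inv_sqrt_one_sub_sq {a b : ℝ} (ha : -1 ≤ a) (hab : a ≤ b) (hb : b ≤ 1) :
    ∫ u in a..b, 1 / √(1 - u ^ 2) = arcsin b - arcsin a := by
  refine intervalIntegral.integral_eq_sub_of_hasDerivAt_of_le hab
    continuous_arcsin.continuousOn ?_ ?_
  · intro u hu
    exact hasDerivAt_arcsin (by linarith [hu.1]) (by linarith [hu.2])
  · refine intervalIntegrable_inv_sqrt_one_sub_sq.mono_set ?_
    rw [Set.uIcc_of_le hab, Set.uIcc_of_le (by norm_num)]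
    exact Set.Icc_subset_Icc ha hb

/-- A bounded factor does not spoil integrability of the Chebyshev weight. -/
lemma intervalIntegrable_mul_inv_sqrt_one_sub_sq {h : ℝ → ℝ} {a b C : ℝ} (ha : -1 ≤ a)
    (hab : a ≤ b) (hb : b ≤ 1)
    (hm : AEStronglyMeasurable h (volume.restrict (Set.Ioc a b)))
    (hC : ∀ u ∈ Set.Ioc a b, |h u| ≤ C) :
    IntervalIntegrable (fun u => h u * (1 / √(1 - u ^ 2))) volume a b := by
  have hw : IntervalIntegrable (fun u : ℝ => 1 / √(1 - u ^ 2)) volume a b := by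
    refine intervalIntegrable_inv_sqrt_one_sub_sq.mono_set ?_
    rw [Set.uIcc_of_le hab, Set.uIcc_of_le (by norm_num)]
    exact Set.Icc_subset_Icc ha hb
  rw [intervalIntegrable_iff_integrableOn_Ioc_of_le hab] at hw ⊢
  refine Integrable.bdd_mul (c := C) hw hm ?_
  exact (ae_restrict_iff' measurableSet_Ioc).2 (Eventually.of_forall hC)

lemma intervalIntegrable_cauchyKernel {x a b δ : ℝ} (ha : -1 ≤ a) (hab : a ≤ b) (hb : b ≤ 1)
    (hδ : 0 < δ) (h : ∀ u ∈ Set.Icc a b, δ ≤ |u - x|) :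
    IntervalIntegrable (fun u => 1 / (√(1 - u ^ 2) * (u - x))) volume a b := by
  have := intervalIntegrable_mul_inv_sqrt_one_sub_sq (h := fun u => (u - x)⁻¹) (C := δ⁻¹) ha hab hb
    (by fun_prop) (fun u hu => by
      rw [abs_inv]
      exact inv_anti₀ hδ (h u (Set.Ioc_subset_Icc_self hu)))
  refine this.congr (fun u _ => ?_)
  simp only [one_div, mul_inv]
  ring

lemma integral_cauchyKernel {x a b δ : ℝ} (hx : x ∈ Set.Ioo (-1 : ℝ) 1) (ha : -1 ≤ a)
    (hab : a ≤ b) (hb : b ≤ 1) (hδ : 0 < δ) (h : ∀ u ∈ Set.Icc a b, δ ≤ |u - x|) :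
    √(1 - x ^ 2) * ∫ u in a..b, 1 / (√(1 - u ^ 2) * (u - x)) =
      cauchyPrimitive x b - cauchyPrimitive x a := by
  have hne : ∀ u ∈ Set.Icc a b, u ≠ x := by
    rintro u hu rfl
    have := h u hu
    simp at this
    linarith
  rw [← intervalIntegral.integral_const_mul]
  refine intervalIntegral.integral_eq_sub_of_hasDerivAt_of_le hab ?_ ?_ ?_
  · exact (continuousOn_cauchyPrimitive hx).mono
      (fun u hu => ⟨⟨ha.trans hu.1, hu.2.trans hb⟩, hne u hu⟩)
  · exact fun u hu => hasDerivAt_cauchyPrimitive hx ⟨ha.trans_lt hu.1, hu.2.trans_le hb⟩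
      (hne u (Set.Ioo_subset_Icc_self hu))
  · exact (intervalIntegrable_cauchyKernel ha hab hb hδ h).const_mul _

/-- The Cauchy principal value of the Chebyshev weight vanishes. -/
lemma tendsto_cauchyPrimitive_symm {x : ℝ} (hx : x ∈ Set.Ioo (-1 : ℝ) 1) :
    Tendsto (fun ε => cauchyPrimitive x (x - ε) - cauchyPrimitive x (x + ε)) (𝓝 0) (𝓝 0) := by
  have hD := cauchyPrimitive_denom_pos hx (Set.Ioo_subset_Icc_self hx)
  have key : (fun ε => cauchyPrimitive x (x - ε) - cauchyPrimitive x (x + ε)) = fun ε =>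
      log (1 - x * (x + ε) + √(1 - x ^ 2) * √(1 - (x + ε) ^ 2)) -
      log (1 - x * (x - ε) + √(1 - x ^ 2) * √(1 - (x - ε) ^ 2)) := by
    ext ε
    have h1 : x - ε - x = -ε := by ring
    have h2 : x + ε - x = ε := by ring
    simp only [cauchyPrimitive, h1, h2, log_neg_eq_log]
    ring
  rw [key]
  have hc : ContinuousAt (fun ε =>
      log (1 - x * (x + ε) + √(1 - x ^ 2) * √(1 - (x + ε) ^ 2)) -
      log (1 - x * (x - ε) + √(1 - x ^ 2) * √(1 - (x - ε) ^ 2))) 0 := by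
    refine ContinuousAt.sub (ContinuousAt.log (by fun_prop) ?_) (ContinuousAt.log (by fun_prop) ?_)
    · simpa using hD.ne'
    · simpa using hD.ne'
  simpa [ContinuousAt] using hc

lemma exists_right_cut {x η L : ℝ} (hx : x ∈ Set.Ioo (-1 : ℝ) 1) (hη : 0 < η)
    (hL : 0 ≤ L) (hLη : exp (-L) ≤ sin (η / 2)) :
    ∃ b ∈ Set.Ioc x 1, arcsin b - arcsin x ≤ η ∧ -cauchyPrimitive x b ≤ L := by
  have hβ1 := neg_pi_div_two_lt_arcsin.2 hx.1
  have hβ2 := arcsin_lt_pi_div_two.2 hx.2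
  rcases le_or_gt (π / 2) (arcsin x + η) with hcase | hcase
  · refine ⟨1, ⟨hx.2, le_rfl⟩, ?_, ?_⟩
    · rw [arcsin_one]; linarith
    · rw [cauchyPrimitive_one]; simpa using hL
  · have hxs : sin (arcsin x) = x := sin_arcsin hx.1.le hx.2.le
    have hcx : √(1 - x ^ 2) = cos (arcsin x) := (cos_arcsin x).symm
    set β := arcsin x with hβ
    have harc : arcsin (sin (β + η)) = β + η := arcsin_sin (by linarith) hcase.le
    have hcb : √(1 - sin (β + η) ^ 2) = cos (β + η) := by rw [← cos_arcsin, harc]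
    have hc0 : 0 < cos (β + η / 2) := cos_pos_of_mem_Ioo ⟨by linarith, by linarith⟩
    have hc1 : cos (β + η / 2) ≤ 1 := cos_le_one _
    have hs0 : 0 < sin (η / 2) := (exp_pos _).trans_le hLη
    have hdiff : sin (β + η) - x = 2 * sin (η / 2) * cos (β + η / 2) := by
      rw [← hxs, sin_sub_sin]
      ring_nf
    have hden : 1 - x * sin (β + η) + √(1 - x ^ 2) * √(1 - sin (β + η) ^ 2) =
        2 * cos (β + η / 2) ^ 2 := by
      rw [hcb, hcx, cos_sq, show 2 * (β + η / 2) = β + (β + η) by ring, cos_add β (β + η), hxs]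
      ring
    refine ⟨sin (β + η), ⟨?_, sin_le_one _⟩, ?_, ?_⟩
    · have : 0 < sin (β + η) - x := by rw [hdiff]; positivity
      linarith
    · rw [harc]; linarith
    · have hLs : -L ≤ log (sin (η / 2)) := (le_log_iff_exp_le hs0).2 hLη
      have hlc : log (cos (β + η / 2)) ≤ 0 := log_nonpos hc0.le hc1
      have e1 : log (2 * sin (η / 2) * cos (β + η / 2)) =
          log 2 + log (sin (η / 2)) + log (cos (β + η / 2)) := by
        rw [log_mul (by positivity) hc0.ne', log_mul two_ne_zero hs0.ne']
      have e2 : log (2 * cos (β + η / 2) ^ 2) = log 2 + 2 * log (cos (β + η / 2)) := by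
        rw [log_mul two_ne_zero (by positivity), log_pow]
        norm_num
      rw [cauchyPrimitive, hdiff, hden, e1, e2]
      linarith

lemma exists_left_cut {x η L : ℝ} (hx : x ∈ Set.Ioo (-1 : ℝ) 1) (hη : 0 < η)
    (hL : 0 ≤ L) (hLη : exp (-L) ≤ sin (η / 2)) :
    ∃ a ∈ Set.Ico (-1) x, arcsin x - arcsin a ≤ η ∧ -cauchyPrimitive x a ≤ L := by
  obtain ⟨b, hb, h1, h2⟩ := exists_right_cut (x := -x)
    ⟨by linarith [hx.2], by linarith [hx.1]⟩ hη hL hLη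
  refine ⟨-b, ⟨by linarith [hb.2], by linarith [hb.1]⟩, ?_, ?_⟩
  · rw [arcsin_neg] at h1 ⊢
    linarith
  · have := cauchyPrimitive_neg_neg x (-b)
    rw [neg_neg] at this
    rwa [← this]

/-- Existence of, and a bound for, the weighted Cauchy principal value of a Lipschitz function
which is uniformly small. -/
lemma exists_cauchyPV_abs_le {g : ℝ → ℝ} {K δ η L x : ℝ}
    (hg : ∀ u ∈ Set.Icc (-1 : ℝ) 1, ∀ v ∈ Set.Icc (-1 : ℝ) 1, |g u - g v| ≤ K * |u - v|)
    (hδ : ∀ u ∈ Set.Icc (-1 : ℝ) 1, |g u| ≤ δ) (hx : x ∈ Set.Ioo (-1 : ℝ) 1)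
    (hη : 0 < η) (hL : 0 ≤ L) (hLη : exp (-L) ≤ sin (η / 2)) :
    ∃ I : ℝ,
      Tendsto (fun ε : ℝ =>
          (∫ u in (-1 : ℝ)..(x - ε), g u / (√(1 - u ^ 2) * (u - x))) +
          ∫ u in (x + ε)..(1 : ℝ), g u / (√(1 - u ^ 2) * (u - x)))
        (𝓝[>] (0 : ℝ)) (𝓝 I) ∧
      √(1 - x ^ 2) * |I| ≤ 2 * K * η + 4 * δ * L := by
  have hxI := Set.Ioo_subset_Icc_self hx
  have hK : 0 ≤ K := by
    have := (abs_nonneg _).trans (hg 1 (by simp) (-1) (by simp))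
    norm_num at this
    exact this
  have hδ0 : 0 ≤ δ := (abs_nonneg _).trans (hδ x hxI)
  have hs : 0 < √(1 - x ^ 2) := sqrt_pos.2 (by nlinarith [hx.1, hx.2])
  have hs1 : √(1 - x ^ 2) ≤ 1 := sqrt_le_one.2 (by nlinarith)
  set s := √(1 - x ^ 2) with hs_def
  have hgc : ContinuousOn g (Set.Icc (-1) 1) := by
    have : LipschitzOnWith K.toNNReal g (Set.Icc (-1) 1) :=
      LipschitzOnWith.of_dist_le_mul (fun u hu v hv => by
        simpa [Real.dist_eq, hK] using hg u hu v hv)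
    exact this.continuousOn
  let H : ℝ → ℝ := fun u => (g u - g x) / (u - x) * (1 / √(1 - u ^ 2))
  have hquot : ∀ u ∈ Set.Icc (-1 : ℝ) 1, |(g u - g x) / (u - x)| ≤ K := by
    intro u hu
    rw [abs_div]
    exact div_le_of_le_mul₀ (abs_nonneg _) hK (hg u hu x hxI)
  have hHint : IntervalIntegrable H volume (-1) 1 := by
    refine intervalIntegrable_mul_inv_sqrt_one_sub_sq le_rfl (by norm_num) le_rfl ?_
      (fun u hu => hquot u (Set.Ioc_subset_Icc_self hu))
    have h1 : AEStronglyMeasurable g (volume.restrict (Set.Ioc (-1 : ℝ) 1)) :=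
      (hgc.mono Set.Ioc_subset_Icc_self).aestronglyMeasurable measurableSet_Ioc
    have h2 : AEStronglyMeasurable (fun u : ℝ => (u - x)⁻¹)
        (volume.restrict (Set.Ioc (-1 : ℝ) 1)) := by fun_prop
    simp only [div_eq_mul_inv]
    exact (h1.sub aestronglyMeasurable_const).mul h2
  have hHsub : ∀ {a b : ℝ}, -1 ≤ a → a ≤ b → b ≤ 1 → IntervalIntegrable H volume a b := by
    intro a b ha hab hb
    refine hHint.mono_set ?_
    rw [Set.uIcc_of_le hab, Set.uIcc_of_le (by norm_num)]
    exact Set.Icc_subset_Icc ha hb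
  have hsplit : ∀ {a b d : ℝ}, -1 ≤ a → a ≤ b → b ≤ 1 → 0 < d →
      (∀ u ∈ Set.Icc a b, d ≤ |u - x|) →
      ∫ u in a..b, g u / (√(1 - u ^ 2) * (u - x)) = (∫ u in a..b, H u) +
        g x / s * (cauchyPrimitive x b - cauchyPrimitive x a) := by
    intro a b d ha hab hb hd h
    rw [← integral_cauchyKernel hx ha hab hb hd h, ← hs_def, ← mul_assoc,
      div_mul_cancel₀ _ hs.ne', ← intervalIntegral.integral_const_mul,
      ← intervalIntegral.integral_add (hHsub ha hab hb)
        ((intervalIntegrable_cauchyKernel ha hab hb hd h).const_mul _)]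
    congr 1
    ext u
    simp only [H, div_eq_mul_inv, mul_inv]
    ring
  refine ⟨∫ u in (-1 : ℝ)..1, H u, ?_, ?_⟩
  · have hlim : Tendsto (fun ε : ℝ => (∫ u in (-1 : ℝ)..(x - ε), H u) +
        (∫ u in (x + ε)..(1 : ℝ), H u) +
        g x / s * (cauchyPrimitive x (x - ε) - cauchyPrimitive x (x + ε)))
        (𝓝[>] (0 : ℝ)) (𝓝 ((∫ u in (-1 : ℝ)..1, H u) + g x / s * 0)) := by
      refine Tendsto.add ?_ (((tendsto_cauchyPrimitive_symm hx).mono_left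
        nhdsWithin_le_nhds).const_mul _)
      have hprim : ContinuousAt (fun c => ∫ u in (-1 : ℝ)..c, H u) x := by
        have := intervalIntegral.continuousOn_primitive_interval' hHint
          (a := -1) (by simp)
        rw [Set.uIcc_of_le (by norm_num)] at this
        exact this.continuousAt (Icc_mem_nhds hx.1 hx.2)
      have hl : Tendsto (fun ε : ℝ => x - ε) (𝓝[>] 0) (𝓝 x) := by
        have : ContinuousAt (fun ε : ℝ => x - ε) 0 := by fun_prop
        simpa [ContinuousAt] using this.tendsto.mono_left nhdsWithin_le_nhds
      have hr : Tendsto (fun ε : ℝ => x + ε) (𝓝[>] 0) (𝓝 x) := by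
        have : ContinuousAt (fun ε : ℝ => x + ε) 0 := by fun_prop
        simpa [ContinuousAt] using this.tendsto.mono_left nhdsWithin_le_nhds
      have := (hprim.tendsto.comp hl).add ((hprim.tendsto.comp hr).const_sub
        (∫ u in (-1 : ℝ)..1, H u))
      rw [add_sub_cancel] at this
      refine this.congr' ?_
      filter_upwards [Ioo_mem_nhdsGT (show (0 : ℝ) < 1 - x by linarith [hx.2])] with ε hε
      simp only [Function.comp]
      congr 1
      rw [sub_eq_iff_eq_add, add_comm]
      exact (intervalIntegral.integral_add_adjacent_intervals
        (hHsub le_rfl (by linarith [hx.1, hε.1]) (by linarith [hε.2]))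
        (hHsub (by linarith [hx.1, hε.1]) (by linarith [hε.2]) le_rfl)).symm
    rw [mul_zero, add_zero] at hlim
    refine hlim.congr' ?_
    filter_upwards [Ioo_mem_nhdsGT (show (0 : ℝ) < 1 - x by linarith [hx.2]),
      Ioo_mem_nhdsGT (show (0 : ℝ) < x + 1 by linarith [hx.1])] with ε hε hε'
    rw [hsplit (d := ε) le_rfl (by linarith [hε'.2]) (by linarith [hx.2, hε.1]) hε.1
        (fun u hu => (by linarith [hu.2] : ε ≤ -(u - x)).trans (neg_le_abs _)),
      hsplit (d := ε) (by linarith [hx.1, hε.1]) (by linarith [hε.2]) le_rfl hε.1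
        (fun u hu => (by linarith [hu.1] : ε ≤ u - x).trans (le_abs_self _)),
      cauchyPrimitive_one, cauchyPrimitive_neg_one]
    ring
  · obtain ⟨a, ha, ha1, ha2⟩ := exists_left_cut hx hη hL hLη
    obtain ⟨b, hb, hb1, hb2⟩ := exists_right_cut hx hη hL hLη
    have hab : a ≤ b := by linarith [ha.2, hb.1]
    have hnum : ∀ u ∈ Set.Icc (-1 : ℝ) 1, |g u - g x| ≤ 2 * δ := fun u hu => by
      linarith [abs_sub (g u) (g x), hδ u hu, hδ x hxI]
    have hHabs : ∀ u, |H u| = |g u - g x| * (1 / (√(1 - u ^ 2) * |u - x|)) := fun u => by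
      simp only [H, abs_mul, abs_div, abs_one, abs_of_nonneg (sqrt_nonneg _)]
      simp only [div_eq_mul_inv, mul_inv]
      ring
    have hleft : s * |∫ u in (-1 : ℝ)..a, H u| ≤ 2 * δ * L := by
      have hd : ∀ u ∈ Set.Icc (-1) a, x - a ≤ |u - x| := fun u hu =>
        (by linarith [hu.2] : x - a ≤ -(u - x)).trans (neg_le_abs _)
      have hd0 : 0 < x - a := sub_pos.2 ha.2
      have ha' : a ≤ 1 := hab.trans hb.2
      have h1 : |∫ u in (-1 : ℝ)..a, H u| ≤
          ∫ u in (-1 : ℝ)..a, -(2 * δ) * (1 / (√(1 - u ^ 2) * (u - x))) := by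
        rw [← norm_eq_abs]
        refine intervalIntegral.norm_integral_le_of_norm_le ha.1 (Eventually.of_forall ?_)
          ((intervalIntegrable_cauchyKernel le_rfl ha.1 ha' hd0 hd).const_mul _)
        intro u hu
        rw [norm_eq_abs, hHabs, abs_of_neg (by linarith [hu.2] : u - x < 0), mul_neg, div_neg]
        rw [mul_neg, neg_mul, ← mul_neg, ← mul_neg]
        refine mul_le_mul_of_nonneg_right (hnum u ⟨hu.1.le, hu.2.trans ha'⟩) ?_
        rw [← div_neg, ← mul_neg]
        have : 0 < -(u - x) := by linarith [hu.2]
        positivity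
      rw [intervalIntegral.integral_const_mul] at h1
      have h2 := integral_cauchyKernel hx le_rfl ha.1 ha' hd0 hd
      rw [cauchyPrimitive_neg_one, sub_zero] at h2
      calc s * _ ≤ s * _ := mul_le_mul_of_nonneg_left h1 hs.le
        _ = 2 * δ * -cauchyPrimitive x a := by rw [← h2]; ring
        _ ≤ 2 * δ * L := by gcongr
    have hright : s * |∫ u in b..(1 : ℝ), H u| ≤ 2 * δ * L := by
      have hd : ∀ u ∈ Set.Icc b 1, b - x ≤ |u - x| := fun u hu =>
        (by linarith [hu.1] : b - x ≤ u - x).trans (le_abs_self _)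
      have hd0 : 0 < b - x := sub_pos.2 hb.1
      have hb' : -1 ≤ b := ha.1.trans hab
      have h1 : |∫ u in b..(1 : ℝ), H u| ≤
          ∫ u in b..(1 : ℝ), (2 * δ) * (1 / (√(1 - u ^ 2) * (u - x))) := by
        rw [← norm_eq_abs]
        refine intervalIntegral.norm_integral_le_of_norm_le hb.2 (Eventually.of_forall ?_)
          ((intervalIntegrable_cauchyKernel hb' hb.2 le_rfl hd0 hd).const_mul _)
        intro u hu
        have : 0 < u - x := by linarith [hu.1]
        rw [norm_eq_abs, hHabs, abs_of_pos this]
        refine mul_le_mul_of_nonneg_right (hnum u ⟨hb'.trans hu.1.le, hu.2⟩) ?_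
        positivity
      rw [intervalIntegral.integral_const_mul] at h1
      have h2 := integral_cauchyKernel hx hb' hb.2 le_rfl hd0 hd
      rw [cauchyPrimitive_one, zero_sub] at h2
      calc s * _ ≤ s * _ := mul_le_mul_of_nonneg_left h1 hs.le
        _ = 2 * δ * -cauchyPrimitive x b := by rw [← h2]; ring
        _ ≤ 2 * δ * L := by gcongr
    have hmid : s * |∫ u in a..b, H u| ≤ 2 * K * η := by
      have h1 : |∫ u in a..b, H u| ≤ ∫ u in a..b, K * (1 / √(1 - u ^ 2)) := by
        rw [← norm_eq_abs]
        refine intervalIntegral.norm_integral_le_of_norm_le hab (Eventually.of_forall ?_) ?_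
        · intro u hu
          rw [norm_eq_abs, abs_mul, abs_of_nonneg (by positivity : 0 ≤ 1 / √(1 - u ^ 2))]
          exact mul_le_mul_of_nonneg_right
            (hquot u ⟨ha.1.trans hu.1.le, hu.2.trans hb.2⟩) (by positivity)
        · exact intervalIntegrable_mul_inv_sqrt_one_sub_sq (C := |K|) ha.1 hab hb.2
            aestronglyMeasurable_const (fun _ _ => le_rfl)
      rw [intervalIntegral.integral_const_mul, integral_inv_sqrt_one_sub_sq ha.1 hab hb.2] at h1
      calc s * _ ≤ 1 * (K * (arcsin b - arcsin a)) := by gcongr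
        _ ≤ 1 * (K * (2 * η)) := by gcongr; linarith
        _ = 2 * K * η := by ring
    have hdecomp : ∫ u in (-1 : ℝ)..1, H u =
        (∫ u in (-1 : ℝ)..a, H u) + (∫ u in a..b, H u) + ∫ u in b..(1 : ℝ), H u := by
      have i1 := hHsub le_rfl ha.1 (hab.trans hb.2)
      have i2 := hHsub ha.1 hab hb.2
      have i3 := hHsub (ha.1.trans hab) hb.2 le_rfl
      rw [intervalIntegral.integral_add_adjacent_intervals i1 i2,
        intervalIntegral.integral_add_adjacent_intervals (i1.trans i2) i3]
    rw [hdecomp]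
    have := mul_le_mul_of_nonneg_left
      (abs_add_three (∫ u in (-1 : ℝ)..a, H u) (∫ u in a..b, H u) (∫ u in b..(1 : ℝ), H u)) hs.le
    linarith

lemma exists_mem_Icc_of_grid (t : ℕ → ℝ) {n : ℕ} (hn : 0 < n) {u : ℝ}
    (hu : u ∈ Set.Icc (t 0) (t n)) : ∃ k < n, u ∈ Set.Icc (t k) (t (k + 1)) := by
  induction n with
  | zero => omega
  | succ n ih =>
    rcases le_or_gt (t n) u with h | h
    · exact ⟨n, by omega, h, hu.2⟩
    · have hn0 : 0 < n := by
        rcases Nat.eq_zero_or_pos n with rfl | h0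
        · exact absurd hu.1 (not_le.2 h)
        · exact h0
      obtain ⟨k, hk, hk'⟩ := ih hn0 ⟨hu.1, h.le⟩
      exact ⟨k, by omega, hk'⟩

/-- A function which is Lipschitz on each cell of a grid is Lipschitz. -/
lemma abs_sub_le_of_grid {S : ℝ → ℝ} {t : ℕ → ℝ} {K : ℝ} {n : ℕ}
    (hmono : ∀ k < n, t k < t (k + 1))
    (h : ∀ k < n, ∀ u ∈ Set.Icc (t k) (t (k + 1)), ∀ v ∈ Set.Icc (t k) (t (k + 1)),
      |S u - S v| ≤ K * |u - v|) :
    ∀ u ∈ Set.Icc (t 0) (t n), ∀ v ∈ Set.Icc (t 0) (t n), |S u - S v| ≤ K * |u - v| := by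
  induction n with
  | zero =>
    intro u hu v hv
    simp only [Set.Icc_self, Set.mem_singleton_iff] at hu hv
    subst hu hv
    simp
  | succ n ih =>
    have ih' := ih (fun k hk => hmono k (by omega)) (fun k hk => h k (by omega))
    have hmid : ∀ u ∈ Set.Icc (t 0) (t n), ∀ v ∈ Set.Icc (t n) (t (n + 1)),
        |S u - S v| ≤ K * |u - v| := by
      intro u hu v hv
      have h1 := ih' u hu (t n) ⟨hu.1.trans hu.2, le_rfl⟩
      have h2 := h n (by omega) (t n) ⟨le_rfl, hv.1.trans hv.2⟩ v hv
      rw [abs_of_nonpos (by linarith [hu.2] : u - t n ≤ 0)] at h1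
      rw [abs_of_nonpos (by linarith [hv.1] : t n - v ≤ 0)] at h2
      rw [abs_of_nonpos (by linarith [hu.2, hv.1] : u - v ≤ 0)]
      have := abs_sub_le (S u) (S (t n)) (S v)
      linarith
    intro u hu v hv
    rcases le_total u (t n) with hu' | hu' <;> rcases le_total v (t n) with hv' | hv'
    · exact ih' u ⟨hu.1, hu'⟩ v ⟨hv.1, hv'⟩
    · exact hmid u ⟨hu.1, hu'⟩ v ⟨hv', hv.2⟩
    · rw [abs_sub_comm (S u), abs_sub_comm u]
      exact hmid v ⟨hv.1, hv'⟩ u ⟨hu', hu.2⟩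
    · exact h n (by omega) u ⟨hu', hu.2⟩ v ⟨hv', hv.2⟩

/-- The error of linear interpolation of a Lipschitz function. -/
lemma abs_sub_linear_interp_le {a b u y y₀ y₁ M : ℝ} (hab : a < b) (hu : u ∈ Set.Icc a b)
    (h0 : |y - y₀| ≤ M * |u - a|) (h1 : |y - y₁| ≤ M * |u - b|) (hM : 0 ≤ M) :
    |y - ((b - u) * y₀ + (u - a) * y₁) / (b - a)| ≤ M * (b - a) / 2 := by
  have hba : 0 < b - a := sub_pos.2 hab
  rw [abs_of_nonneg (by linarith [hu.1] : 0 ≤ u - a)] at h0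
  rw [abs_of_nonpos (by linarith [hu.2] : u - b ≤ 0)] at h1
  have e : y - ((b - u) * y₀ + (u - a) * y₁) / (b - a) =
      ((b - u) * (y - y₀) + (u - a) * (y - y₁)) / (b - a) := by
    field_simp
    ring
  rw [e, abs_div, abs_of_pos hba, div_le_iff₀ hba]
  have h2 : |(b - u) * (y - y₀) + (u - a) * (y - y₁)| ≤
      (b - u) * (M * (u - a)) + (u - a) * (M * (-(u - b))) := by
    refine (abs_add_le _ _).trans ?_
    rw [abs_mul, abs_mul, abs_of_nonneg (by linarith [hu.2] : 0 ≤ b - u),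
      abs_of_nonneg (by linarith [hu.1] : 0 ≤ u - a)]
    exact add_le_add (mul_le_mul_of_nonneg_left h0 (by linarith [hu.2]))
      (mul_le_mul_of_nonneg_left h1 (by linarith [hu.1]))
  nlinarith [mul_nonneg hM (sq_nonneg ((b - u) - (u - a)))]

/-- **Theorem 1, class W¹[−1,1] (Table 1, row 1).**
Let `Δ : −1 = t₀ < ⋯ < t_N = 1` (`N ≥ 3`) be a grid with steps `h_k = t_{k+1} − t_k ≤ γ/N`,
let `S` be the linear interpolating spline of `f` on `Δ`, and let `f` be Lipschitz with
constant `M₁` on `[−1,1]`.  Then for every `x ∈ (−1,1)` the Cauchy principal value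
`R_N(f,x) = J(f − S, x)` exists and
`|R_N(f,x)| ≤ (4γM₁/π)·(1 + π√2/(2γ ln N))·(ln N)/N`. -/
theorem quadrature_error_W1_table1
    (N : ℕ) (hN : 3 ≤ N)
    (t : ℕ → ℝ) (ht0 : t 0 = -1) (htN : t N = 1)
    (hmono : ∀ k, k < N → t k < t (k + 1))
    (γ : ℝ) (hγ : 0 < γ)
    (hstep : ∀ k, k < N → t (k + 1) - t k ≤ γ / N)
    (f S : ℝ → ℝ) (M₁ : ℝ)
    (hf : ∀ u ∈ Set.Icc (-1 : ℝ) 1, ∀ v ∈ Set.Icc (-1 : ℝ) 1,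
      |f u - f v| ≤ M₁ * |u - v|)
    (hS : ∀ k, k < N → ∀ u ∈ Set.Icc (t k) (t (k + 1)),
      S u = ((t (k + 1) - u) * f (t k) + (u - t k) * f (t (k + 1))) / (t (k + 1) - t k))
    (x : ℝ) (hx : x ∈ Set.Ioo (-1 : ℝ) 1) :
    ∃ I : ℝ,
      Tendsto (fun ε : ℝ =>
          (∫ u in (-1 : ℝ)..(x - ε), (f u - S u) / (Real.sqrt (1 - u ^ 2) * (u - x))) +
          ∫ u in (x + ε)..(1 : ℝ), (f u - S u) / (Real.sqrt (1 - u ^ 2) * (u - x)))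
        (𝓝[>] (0 : ℝ)) (𝓝 I) ∧
      |Real.sqrt (1 - x ^ 2) / π * I| ≤
        (4 * γ * M₁ / π) * (1 + π * Real.sqrt 2 / (2 * γ * Real.log N)) *
          Real.log N / N := by
  have hN0 : (0 : ℝ) < N := by exact_mod_cast (by omega : 0 < N)
  have hN3 : (3 : ℝ) ≤ N := by exact_mod_cast hN
  have hM : 0 ≤ M₁ := by
    have := (abs_nonneg _).trans (hf 1 (by simp) (-1) (by simp))
    norm_num at this
    exact this
  have htm : ∀ k, k ≤ N → t 0 ≤ t k := by
    intro k
    induction k with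
    | zero => exact fun _ => le_rfl
    | succ k ih => exact fun hk => (ih (by omega)).trans (hmono k (by omega)).le
  have htM : ∀ j, j ≤ N → t (N - j) ≤ t N := by
    intro j
    induction j with
    | zero => exact fun _ => le_rfl
    | succ j ih =>
      intro hj
      have := hmono (N - (j + 1)) (by omega)
      rw [show N - (j + 1) + 1 = N - j by omega] at this
      exact this.le.trans (ih (by omega))
  have htI : ∀ k, k ≤ N → t k ∈ Set.Icc (-1 : ℝ) 1 := by
    intro k hk
    have h := htM (N - k) (by omega)
    rw [show N - (N - k) = k by omega] at h
    exact ⟨ht0 ▸ htm k hk, htN ▸ h⟩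
  have hSlip : ∀ u ∈ Set.Icc (-1 : ℝ) 1, ∀ v ∈ Set.Icc (-1 : ℝ) 1,
      |S u - S v| ≤ M₁ * |u - v| := by
    have := abs_sub_le_of_grid (S := S) (K := M₁) hmono (fun k hk u hu v hv => ?_)
    · rwa [ht0, htN] at this
    have hpos : 0 < t (k + 1) - t k := sub_pos.2 (hmono k hk)
    have e : S u - S v = (f (t (k + 1)) - f (t k)) * (u - v) / (t (k + 1) - t k) := by
      rw [hS k hk u hu, hS k hk v hv, ← sub_div]
      ring
    rw [e, abs_div, abs_mul, abs_of_pos hpos, div_le_iff₀ hpos]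
    have h := hf _ (htI (k + 1) hk) _ (htI k hk.le)
    rw [abs_of_pos hpos] at h
    calc _ ≤ M₁ * (t (k + 1) - t k) * |u - v| := by gcongr
      _ = _ := by ring
  have hglip : ∀ u ∈ Set.Icc (-1 : ℝ) 1, ∀ v ∈ Set.Icc (-1 : ℝ) 1,
      |(f u - S u) - (f v - S v)| ≤ 2 * M₁ * |u - v| := by
    intro u hu v hv
    rw [show (f u - S u) - (f v - S v) = (f u - f v) - (S u - S v) by ring]
    linarith [abs_sub (f u - f v) (S u - S v), hf u hu v hv, hSlip u hu v hv]
  have hgsmall : ∀ u ∈ Set.Icc (-1 : ℝ) 1, |f u - S u| ≤ M₁ * (γ / N) / 2 := by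
    intro u hu
    obtain ⟨k, hk, hku⟩ := exists_mem_Icc_of_grid t (by omega : 0 < N) (u := u)
      (by rwa [ht0, htN])
    rw [hS k hk u hku]
    refine (abs_sub_linear_interp_le (hmono k hk) hku (hf u hu _ (htI k hk.le))
      (hf u hu _ (htI (k + 1) hk)) hM).trans ?_
    gcongr
    exact hstep k hk
  have hlog : 0 < log N := log_pos (by linarith)
  have hsin : exp (-(2 * log N)) ≤ sin (2 / (N : ℝ) / 2) := by
    have e1 : exp (-(2 * log N)) = (1 / (N : ℝ)) ^ 2 := by
      rw [exp_neg, two_mul, exp_add, exp_log hN0]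
      field_simp
    have e2 : 2 / (N : ℝ) / 2 = 1 / N := by ring
    rw [e1, e2]
    have hy0 : 0 < 1 / (N : ℝ) := by positivity
    have hy1 : 1 / (N : ℝ) ≤ 1 / 3 := one_div_le_one_div_of_le (by norm_num) hN3
    have := sin_gt_sub_cube hy0
    nlinarith [mul_nonneg hy0.le (sub_nonneg.2 hy1), pow_pos hy0 2, pow_pos hy0 3]
  obtain ⟨I, hI, hbound⟩ := exists_cauchyPV_abs_le (g := fun u => f u - S u) hglip hgsmall hx
    (η := 2 / N) (by positivity) (by positivity) hsin
  refine ⟨I, hI, ?_⟩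
  have hs2 : 4 ≤ π * √2 := by
    have h1 : (1.4 : ℝ) ≤ √2 := le_sqrt_of_sq_le (by norm_num)
    nlinarith [pi_gt_three]
  have hR : (4 * γ * M₁ / π) * (1 + π * √2 / (2 * γ * log N)) * log N / N =
      (4 * γ * M₁ * log N + 2 * M₁ * (π * √2)) / N / π := by
    field_simp
    ring
  have hE : 2 * (2 * M₁) * (2 / N) + 4 * (M₁ * (γ / N) / 2) * (2 * log N) =
      (4 * γ * M₁ * log N + 2 * M₁ * 4) / N := by
    field_simp
    ring
  rw [hR, abs_mul, abs_of_nonneg (by positivity : 0 ≤ √(1 - x ^ 2) / π), div_mul_eq_mul_div]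
  refine div_le_div_of_nonneg_right (hbound.trans ?_) pi_pos.le
  rw [hE]
  gcongr
end

section
/- Let f belong to CC^{1,α}_Δ[−1,1] with constants K₁ and 0 < α ≤ 1. Then for every x ∈ (−1,1) the Cauchy principal value R_N(f,x) = J(f − S_N, x) exists and satisfies |R_N(f,x)| ≤ (2γ^{1+α}K₁/π)·(1 + π√2/(2γ·ln N))·(ln N)/N^{1+α}. -/
open Real MeasureTheory Filter Topology

/-- A function dominated by a derivative on the open interval is integrable there, and its integral
is bounded by the increment of the primitive. -/
lemma intervalIntegrable_and_abs_integral_le_sub {a b : ℝ} (hab : a ≤ b) {q g G : ℝ → ℝ}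
    (hG : ContinuousOn G (Set.Icc a b)) (hd : ∀ u ∈ Set.Ioo a b, HasDerivAt G (g u) u)
    (hq : ContinuousOn q (Set.Ioo a b)) (hqg : ∀ u ∈ Set.Ioo a b, |q u| ≤ g u) :
    IntervalIntegrable q volume a b ∧ |∫ u in a..b, q u| ≤ G b - G a := by
  have hgO : IntegrableOn g (Set.Ioc a b) volume :=
    intervalIntegral.integrableOn_deriv_of_nonneg hG hd
      fun u hu => (abs_nonneg _).trans (hqg u hu)
  have hgi : IntervalIntegrable g volume a b :=
    (intervalIntegrable_iff_integrableOn_Ioc_of_le hab).2 hgO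
  have hqi : IntervalIntegrable q volume a b := by
    rw [intervalIntegrable_iff_integrableOn_Ioo_of_le hab]
    refine Integrable.mono' (hgO.mono_set Set.Ioo_subset_Ioc_self)
      (hq.aestronglyMeasurable measurableSet_Ioo) ?_
    filter_upwards [ae_restrict_mem measurableSet_Ioo] with u hu using hqg u hu
  refine ⟨hqi, ?_⟩
  rw [← intervalIntegral.integral_eq_sub_of_hasDerivAt_of_le hab hG hd hgi]
  calc |∫ u in a..b, q u| ≤ ∫ u in a..b, |q u| :=
        intervalIntegral.abs_integral_le_integral_abs hab
    _ ≤ _ := intervalIntegral.integral_mono_on_of_le_Ioo hab hqi.abs hgi hqg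

lemma one_sub_sq_pos {x : ℝ} (hx : x ∈ Set.Ioo (-1 : ℝ) 1) : 0 < 1 - x ^ 2 := by
  nlinarith [hx.1, hx.2]

/-- The numerator inside the logarithm of the primitive of the Chebyshev-weighted Cauchy kernel. -/
noncomputable def kernelNum (x u : ℝ) : ℝ := 1 - x * u + √(1 - x ^ 2) * √(1 - u ^ 2)

lemma continuous_kernelNum (x : ℝ) : Continuous (kernelNum x) := by
  unfold kernelNum
  fun_prop

lemma kernelNum_pos {x u : ℝ} (hx : x ∈ Set.Ioo (-1 : ℝ) 1) (hu : u ∈ Set.Icc (-1 : ℝ) 1) :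
    0 < kernelNum x u := by
  have h : 0 ≤ √(1 - x ^ 2) * √(1 - u ^ 2) := by positivity
  have h1 : x * u < 1 := by
    have : |x| < 1 := abs_lt.2 hx
    have hu' : |u| ≤ 1 := abs_le.2 hu
    calc x * u ≤ |x| * |u| := (le_abs_self _).trans_eq (abs_mul x u)
      _ ≤ |x| := mul_le_of_le_one_right (abs_nonneg x) hu'
      _ < 1 := this
  unfold kernelNum
  linarith

lemma kernelNum_le_two {x u : ℝ} (hx : x ∈ Set.Ioo (-1 : ℝ) 1) (hu : u ∈ Set.Icc (-1 : ℝ) 1) :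
    kernelNum x u ≤ 2 := by
  have h1 := Real.sq_sqrt (one_sub_sq_pos hx).le
  have h2 := Real.sq_sqrt (show 0 ≤ 1 - u ^ 2 by nlinarith [hu.1, hu.2])
  unfold kernelNum
  nlinarith [sq_nonneg (√(1 - x ^ 2) - √(1 - u ^ 2)), sq_nonneg (x + u)]

lemma kernelNum_one (x : ℝ) : kernelNum x 1 = 1 - x := by
  simp [kernelNum]

lemma kernelNum_self {x : ℝ} (hx : x ∈ Set.Ioo (-1 : ℝ) 1) :
    kernelNum x x = 2 * (1 - x ^ 2) := by
  have h1 := Real.mul_self_sqrt (one_sub_sq_pos hx).le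
  unfold kernelNum
  linarith

lemma hasDerivAt_log_kernel {x u : ℝ} (hx : x ∈ Set.Ioo (-1 : ℝ) 1) (hxu : x < u) (hu : u < 1) :
    HasDerivAt (fun u => (log (u - x) - log (kernelNum x u)) / √(1 - x ^ 2))
      (1 / (√(1 - u ^ 2) * (u - x))) u := by
  have hu' : u ∈ Set.Ioo (-1 : ℝ) 1 := ⟨hx.1.trans hxu, hu⟩
  have hc : 0 < √(1 - x ^ 2) := Real.sqrt_pos.2 (one_sub_sq_pos hx)
  have hs : 0 < √(1 - u ^ 2) := Real.sqrt_pos.2 (one_sub_sq_pos hu')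
  have hP := kernelNum_pos hx (Set.Ioo_subset_Icc_self hu')
  have hdx : 0 < u - x := sub_pos.2 hxu
  have hc2 := Real.sq_sqrt (one_sub_sq_pos hx).le
  have hs2 := Real.sq_sqrt (one_sub_sq_pos hu').le
  have d1 : HasDerivAt (fun u : ℝ => 1 - u ^ 2) (-(2 * u)) u := by
    simpa using (hasDerivAt_pow 2 u).const_sub 1
  have d2 := (d1.sqrt (one_sub_sq_pos hu').ne').const_mul (√(1 - x ^ 2))
  have d3 : HasDerivAt (kernelNum x)
      (-x + √(1 - x ^ 2) * (-(2 * u) / (2 * √(1 - u ^ 2)))) u := by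
    have := (((hasDerivAt_id u).const_mul x).const_sub 1).add d2
    exact this.congr_deriv (by ring)
  have d4 : HasDerivAt (fun u => log (u - x)) (1 / (u - x)) u :=
    ((hasDerivAt_id u).sub_const x).log hdx.ne'
  have d := (d4.sub (d3.log hP.ne')).div_const (√(1 - x ^ 2))
  refine d.congr_deriv ?_
  unfold kernelNum at hP ⊢
  set c := √(1 - x ^ 2)
  set s := √(1 - u ^ 2)
  have hP' := hP.ne'
  have hdx' := hdx.ne'
  rw [div_sub_div _ _ hdx' hP', div_div, div_eq_div_iff (by positivity) (by positivity)]
  field_simp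
  linear_combination c * hs2 - s * hc2


lemma kernel_integral {x a : ℝ} (hx : x ∈ Set.Ioo (-1 : ℝ) 1) (hxa : x < a) (ha : a ≤ 1) :
    IntervalIntegrable (fun u => 1 / (√(1 - u ^ 2) * (u - x))) volume a 1 ∧
      ∫ u in a..1, 1 / (√(1 - u ^ 2) * (u - x)) =
        (log (kernelNum x a) - log (a - x)) / √(1 - x ^ 2) := by
  have hG : ContinuousOn (fun u => (log (u - x) - log (kernelNum x u)) / √(1 - x ^ 2))
      (Set.Icc a 1) := by
    refine ContinuousOn.div_const (ContinuousOn.sub ?_ ?_) _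
    · exact ContinuousOn.log (by fun_prop) fun u hu => (sub_pos.2 (hxa.trans_le hu.1)).ne'
    · exact (continuous_kernelNum x).continuousOn.log fun u hu =>
        (kernelNum_pos hx ⟨(hx.1.trans (hxa.trans_le hu.1)).le, hu.2⟩).ne'
  have hd : ∀ u ∈ Set.Ioo a 1, HasDerivAt
      (fun u => (log (u - x) - log (kernelNum x u)) / √(1 - x ^ 2))
      (1 / (√(1 - u ^ 2) * (u - x))) u :=
    fun u hu => hasDerivAt_log_kernel hx (hxa.trans hu.1) hu.2
  have hi : IntervalIntegrable (fun u => 1 / (√(1 - u ^ 2) * (u - x))) volume a 1 := by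
    rw [intervalIntegrable_iff_integrableOn_Ioc_of_le ha]
    refine intervalIntegral.integrableOn_deriv_of_nonneg hG hd fun u hu => ?_
    have : 0 < u - x := sub_pos.2 (hxa.trans hu.1)
    positivity
  refine ⟨hi, ?_⟩
  rw [intervalIntegral.integral_eq_sub_of_hasDerivAt_of_le ha hG hd hi, kernelNum_one]
  ring

/-- The part of the singular integral over `[x, v]`, for a density vanishing linearly at `x`. -/
lemma weighted_abs_integral_le_of_linear {x v A : ℝ} (hx : x ∈ Set.Ioo (-1 : ℝ) 1)
    (hxv : x ≤ v) (hv : v ≤ 1)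
    {D : ℝ → ℝ} (hD : ContinuousOn D (Set.Icc x 1))
    (hA : ∀ u ∈ Set.Icc x 1, |D u| ≤ A * (u - x)) :
    IntervalIntegrable (fun u => D u / (√(1 - u ^ 2) * (u - x))) volume x v ∧
      √(1 - x ^ 2) * |∫ u in x..v, D u / (√(1 - u ^ 2) * (u - x))| ≤ 2 * A * (v - x) := by
  have hc : 0 < √(1 - x ^ 2) := Real.sqrt_pos.2 (one_sub_sq_pos hx)
  have hx1 : 0 < 1 - x := sub_pos.2 hx.2
  have hA0 : 0 ≤ A := by
    have := (abs_nonneg _).trans (hA 1 ⟨hx.2.le, le_rfl⟩)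
    exact nonneg_of_mul_nonneg_left this hx1
  have key := intervalIntegrable_and_abs_integral_le_sub (a := x) (b := v) hxv
    (q := fun u => D u / (√(1 - u ^ 2) * (u - x)))
    (g := fun u => A * √(1 - x) / (√(1 - x ^ 2) * √(1 - u)))
    (G := fun u => -(2 * A * √(1 - x) / √(1 - x ^ 2)) * √(1 - u))
    (by fun_prop) ?_ ?_ ?_
  · refine ⟨key.1, ?_⟩
    have h1 := Real.sq_sqrt hx1.le
    have h2 := Real.sq_sqrt (sub_nonneg.2 hv)
    calc √(1 - x ^ 2) * |∫ u in x..v, D u / (√(1 - u ^ 2) * (u - x))|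
        ≤ √(1 - x ^ 2) * (-(2 * A * √(1 - x) / √(1 - x ^ 2)) * √(1 - v) -
          -(2 * A * √(1 - x) / √(1 - x ^ 2)) * √(1 - x)) :=
          mul_le_mul_of_nonneg_left key.2 hc.le
      _ = 2 * A * (√(1 - x) * (√(1 - x) - √(1 - v))) := by field_simp; ring
      _ ≤ 2 * A * (v - x) := by
        refine mul_le_mul_of_nonneg_left ?_ (by positivity)
        have : √(1 - v) ≤ √(1 - x) := Real.sqrt_le_sqrt (by linarith)
        nlinarith [Real.sqrt_nonneg (1 - v)]
  · intro u hu
    have hu1 : 0 < 1 - u := by linarith [hu.2]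
    have d := (((hasDerivAt_id u).const_sub 1).sqrt hu1.ne').const_mul
      (-(2 * A * √(1 - x) / √(1 - x ^ 2)))
    refine d.congr_deriv ?_
    have : 0 < √(1 - u) := Real.sqrt_pos.2 hu1
    simp only [id]
    field_simp
  · refine ContinuousOn.div (hD.mono fun u hu => ⟨hu.1.le, hu.2.le.trans hv⟩) (by fun_prop) ?_
    intro u hu
    have hs : 0 < √(1 - u ^ 2) :=
      Real.sqrt_pos.2 (one_sub_sq_pos ⟨hx.1.trans hu.1, hu.2.trans_le hv⟩)
    have := sub_pos.2 hu.1
    positivity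
  · intro u hu
    have hu1 : 0 < 1 - u := by linarith [hu.2]
    have hs : 0 < √(1 - u ^ 2) :=
      Real.sqrt_pos.2 (one_sub_sq_pos ⟨hx.1.trans hu.1, hu.2.trans_le hv⟩)
    have hsu : 0 < √(1 - u) := Real.sqrt_pos.2 hu1
    have hdx := sub_pos.2 hu.1
    have hle : √(1 - x ^ 2) * √(1 - u) ≤ √(1 - x) * √(1 - u ^ 2) := by
      rw [← Real.sqrt_mul (one_sub_sq_pos hx).le, ← Real.sqrt_mul hx1.le]
      refine Real.sqrt_le_sqrt ?_
      have : 0 ≤ (1 - x) * (1 - u) * (u - x) := by positivity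
      linarith
    rw [abs_div, abs_of_pos (mul_pos hs hdx), div_le_div_iff₀ (by positivity) (by positivity)]
    calc |D u| * (√(1 - x ^ 2) * √(1 - u))
        ≤ (A * (u - x)) * (√(1 - x) * √(1 - u ^ 2)) :=
          mul_le_mul (hA u ⟨hu.1.le, hu.2.le.trans hv⟩) hle (by positivity) (by positivity)
      _ = _ := by ring

/-- The part of the singular integral over `[v, 1]`, for a bounded density. -/
lemma weighted_abs_integral_le_of_bounded {x v B : ℝ} (hx : x ∈ Set.Ioo (-1 : ℝ) 1)
    (hxv : x < v) (hv : v ≤ 1)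
    {D : ℝ → ℝ} (hD : ContinuousOn D (Set.Icc x 1)) (hB : ∀ u ∈ Set.Icc x 1, |D u| ≤ B) :
    IntervalIntegrable (fun u => D u / (√(1 - u ^ 2) * (u - x))) volume v 1 ∧
      √(1 - x ^ 2) * |∫ u in v..1, D u / (√(1 - u ^ 2) * (u - x))| ≤ B * log (2 / (v - x)) := by
  have hc : 0 < √(1 - x ^ 2) := Real.sqrt_pos.2 (one_sub_sq_pos hx)
  have hB0 : 0 ≤ B := (abs_nonneg _).trans (hB 1 ⟨hx.2.le, le_rfl⟩)
  have key := intervalIntegrable_and_abs_integral_le_sub (a := v) (b := 1) hv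
    (q := fun u => D u / (√(1 - u ^ 2) * (u - x)))
    (g := fun u => B * (1 / (√(1 - u ^ 2) * (u - x))))
    (G := fun u => B * ((log (u - x) - log (kernelNum x u)) / √(1 - x ^ 2))) ?_ ?_ ?_ ?_
  · refine ⟨key.1, ?_⟩
    have hP := kernelNum_pos hx (u := v) ⟨(hx.1.trans hxv).le, hv⟩
    have hP2 := kernelNum_le_two hx (u := v) ⟨(hx.1.trans hxv).le, hv⟩
    calc √(1 - x ^ 2) * |∫ u in v..1, D u / (√(1 - u ^ 2) * (u - x))|
        ≤ √(1 - x ^ 2) * (B * ((log (1 - x) - log (kernelNum x 1)) / √(1 - x ^ 2)) -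
          B * ((log (v - x) - log (kernelNum x v)) / √(1 - x ^ 2))) :=
          mul_le_mul_of_nonneg_left key.2 hc.le
      _ = B * (log (kernelNum x v) - log (v - x)) := by
        rw [kernelNum_one]
        field_simp
        ring
      _ ≤ B * log (2 / (v - x)) := by
        rw [Real.log_div two_ne_zero (sub_pos.2 hxv).ne']
        gcongr
  · refine ContinuousOn.mul continuousOn_const (ContinuousOn.div_const (ContinuousOn.sub ?_ ?_) _)
    · exact ContinuousOn.log (by fun_prop) fun u hu => (sub_pos.2 (hxv.trans_le hu.1)).ne'
    · exact (continuous_kernelNum x).continuousOn.log fun u hu =>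
        (kernelNum_pos hx ⟨(hx.1.trans (hxv.trans_le hu.1)).le, hu.2⟩).ne'
  · exact fun u hu => (hasDerivAt_log_kernel hx (hxv.trans hu.1) hu.2).const_mul B
  · refine ContinuousOn.div (hD.mono fun u hu => ⟨(hxv.trans hu.1).le, hu.2.le⟩) (by fun_prop) ?_
    intro u hu
    have hs : 0 < √(1 - u ^ 2) :=
      Real.sqrt_pos.2 (one_sub_sq_pos ⟨hx.1.trans (hxv.trans hu.1), hu.2⟩)
    have := sub_pos.2 (hxv.trans hu.1)
    positivity
  · intro u hu
    have hs : 0 < √(1 - u ^ 2) :=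
      Real.sqrt_pos.2 (one_sub_sq_pos ⟨hx.1.trans (hxv.trans hu.1), hu.2⟩)
    have hdx := sub_pos.2 (hxv.trans hu.1)
    rw [abs_div, abs_of_pos (mul_pos hs hdx), mul_one_div]
    have := hB u ⟨(hxv.trans hu.1).le, hu.2.le⟩
    gcongr

lemma weighted_abs_integral_le_add_log {x A B δ : ℝ} (hx : x ∈ Set.Ioo (-1 : ℝ) 1)
    (hδ : 0 < δ) (hδ2 : δ ≤ 2)
    {D : ℝ → ℝ} (hD : ContinuousOn D (Set.Icc x 1))
    (hA : ∀ u ∈ Set.Icc x 1, |D u| ≤ A * (u - x)) (hB : ∀ u ∈ Set.Icc x 1, |D u| ≤ B) :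
    IntervalIntegrable (fun u => D u / (√(1 - u ^ 2) * (u - x))) volume x 1 ∧
      |√(1 - x ^ 2) * ∫ u in x..1, D u / (√(1 - u ^ 2) * (u - x))| ≤
        2 * A * δ + B * log (2 / δ) := by
  have hn := weighted_abs_integral_le_of_linear hx hx.2.le le_rfl hD hA
  refine ⟨hn.1, ?_⟩
  have hc : 0 ≤ √(1 - x ^ 2) := Real.sqrt_nonneg _
  rw [abs_mul, abs_of_nonneg hc]
  rcases le_or_gt 1 (x + δ) with h | h
  · have hA0 : 0 ≤ A := by
      have := (abs_nonneg _).trans (hA 1 ⟨hx.2.le, le_rfl⟩)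
      exact nonneg_of_mul_nonneg_left this (sub_pos.2 hx.2)
    have hB0 : 0 ≤ B := (abs_nonneg _).trans (hB 1 ⟨hx.2.le, le_rfl⟩)
    have hl : 0 ≤ log (2 / δ) := Real.log_nonneg ((one_le_div hδ).2 hδ2)
    have h1 : 2 * A * (1 - x) ≤ 2 * A * δ := by gcongr; linarith
    have h2 := mul_nonneg hB0 hl
    linarith [hn.2]
  · have n := weighted_abs_integral_le_of_linear hx (v := x + δ) (by linarith) h.le hD hA
    have m := weighted_abs_integral_le_of_bounded hx (v := x + δ) (by linarith) h.le hD hB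
    rw [← intervalIntegral.integral_add_adjacent_intervals n.1 m.1]
    have n2 := n.2
    have m2 := m.2
    rw [add_sub_cancel_left] at n2 m2
    calc _ ≤ √(1 - x ^ 2) * (|∫ u in x..x + δ, D u / (√(1 - u ^ 2) * (u - x))| +
          |∫ u in x + δ..1, D u / (√(1 - u ^ 2) * (u - x))|) :=
          mul_le_mul_of_nonneg_left (abs_add_le _ _) hc
      _ ≤ _ := by rw [mul_add]; exact add_le_add n2 m2

/-- The truncated integral to the right of the singular point diverges exactly like a logarithm. -/
lemma one_sided_limit {x A B δ : ℝ} (hx : x ∈ Set.Ioo (-1 : ℝ) 1) (hδ : 0 < δ) (hδ2 : δ ≤ 2)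
    {e : ℝ → ℝ} (he : ContinuousOn e (Set.Icc x 1))
    (hA : ∀ u ∈ Set.Icc x 1, |e u - e x| ≤ A * (u - x))
    (hB : ∀ u ∈ Set.Icc x 1, |e u - e x| ≤ B) :
    ∃ I : ℝ, |√(1 - x ^ 2) * I| ≤ 2 * A * δ + B * log (2 / δ) ∧
      Tendsto (fun ε => (∫ u in x + ε..1, e u / (√(1 - u ^ 2) * (u - x))) +
        e x / √(1 - x ^ 2) * log ε) (𝓝[>] 0)
        (𝓝 (I + e x / √(1 - x ^ 2) * log (2 * (1 - x ^ 2)))) := by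
  have hD : ContinuousOn (fun u => e u - e x) (Set.Icc x 1) := he.sub continuousOn_const
  obtain ⟨hi, hb⟩ := weighted_abs_integral_le_add_log hx hδ hδ2 hD hA hB
  refine ⟨_, hb, ?_⟩
  have hlt : 0 < 1 - x := sub_pos.2 hx.2
  have hsmall : ∀ᶠ ε : ℝ in 𝓝[>] 0, ε ∈ Set.Ioo 0 (1 - x) := Ioo_mem_nhdsGT hlt
  have htend : Tendsto (fun ε => x + ε) (𝓝[>] 0) (𝓝[Set.uIcc x 1] x) := by
    refine tendsto_nhdsWithin_iff.2 ⟨?_, ?_⟩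
    · have : Tendsto (fun ε : ℝ => x + ε) (𝓝 0) (𝓝 (x + 0)) :=
        (continuous_const.add continuous_id).tendsto 0
      rw [add_zero] at this
      exact this.mono_left nhdsWithin_le_nhds
    · filter_upwards [hsmall] with ε hε
      rw [Set.uIcc_of_le hx.2.le]
      exact ⟨by linarith [hε.1], by linarith [hε.2]⟩
  have t1 := ((intervalIntegral.continuousOn_primitive_interval_left
    ((intervalIntegrable_iff' (a := x) (b := 1)).1 hi)) x Set.left_mem_uIcc).tendsto.comp htend
  have t2 : Tendsto (fun ε => log (kernelNum x (x + ε))) (𝓝[>] 0)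
      (𝓝 (log (2 * (1 - x ^ 2)))) := by
    rw [← kernelNum_self hx]
    have hP := kernelNum_pos hx (Set.Ioo_subset_Icc_self hx)
    exact ((continuous_kernelNum x).continuousAt.log hP.ne').tendsto.comp
      (htend.mono_right nhdsWithin_le_nhds)
  refine (t1.add (t2.const_mul (e x / √(1 - x ^ 2)))).congr' ?_
  filter_upwards [hsmall] with ε hε
  have hk := kernel_integral hx (a := x + ε) (by linarith [hε.1]) (by linarith [hε.2])
  have hsub : IntervalIntegrable (fun u => (e u - e x) / (√(1 - u ^ 2) * (u - x)))
      volume (x + ε) 1 := by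
    refine hi.mono_set ?_
    rw [Set.uIcc_of_le (by linarith [hε.2]), Set.uIcc_of_le hx.2.le]
    exact Set.Icc_subset_Icc_left (by linarith [hε.1])
  have hsplit : ∫ u in x + ε..1, e u / (√(1 - u ^ 2) * (u - x)) =
      (∫ u in x + ε..1, (e u - e x) / (√(1 - u ^ 2) * (u - x))) +
        e x * ∫ u in x + ε..1, 1 / (√(1 - u ^ 2) * (u - x)) := by
    rw [← intervalIntegral.integral_const_mul, ← intervalIntegral.integral_add hsub
      (hk.1.const_mul _)]
    congr 1
    ext u
    ring
  rw [hsplit, hk.2, add_sub_cancel_left]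
  simp only [Function.comp]
  ring

/-- The weighted principal value integral of a Lipschitz function of bounded oscillation exists, and
is bounded uniformly in the singular point. -/
lemma principal_value_bound {x A B δ : ℝ} (hx : x ∈ Set.Ioo (-1 : ℝ) 1) (hδ : 0 < δ) (hδ2 : δ ≤ 2)
    {e : ℝ → ℝ} (hA : ∀ u ∈ Set.Icc (-1 : ℝ) 1, ∀ v ∈ Set.Icc (-1 : ℝ) 1, |e u - e v| ≤ A * |u - v|)
    (hB : ∀ u ∈ Set.Icc (-1 : ℝ) 1, ∀ v ∈ Set.Icc (-1 : ℝ) 1, |e u - e v| ≤ B) :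
    ∃ I : ℝ,
      Tendsto (fun ε : ℝ =>
          (∫ u in (-1 : ℝ)..(x - ε), e u / (√(1 - u ^ 2) * (u - x))) +
          ∫ u in (x + ε)..(1 : ℝ), e u / (√(1 - u ^ 2) * (u - x)))
        (𝓝[>] (0 : ℝ)) (𝓝 I) ∧
      |√(1 - x ^ 2) * I| ≤ 2 * (2 * A * δ + B * log (2 / δ)) := by
  have hx' : -x ∈ Set.Ioo (-1 : ℝ) 1 := ⟨by linarith [hx.2], by linarith [hx.1]⟩
  have hcont : ContinuousOn e (Set.Icc (-1) 1) := by
    refine LipschitzOnWith.continuousOn (K := A.toNNReal) (LipschitzOnWith.of_dist_le_mul ?_)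
    intro u hu v hv
    rw [Real.dist_eq, Real.dist_eq]
    refine (hA u hu v hv).trans ?_
    gcongr
    exact Real.le_coe_toNNReal A
  have hneg : ∀ u ∈ Set.Icc (-x) 1, -u ∈ Set.Icc (-1 : ℝ) 1 := fun u hu =>
    ⟨by linarith [hu.2], by linarith [hu.1, hx.2]⟩
  have hpos : ∀ u ∈ Set.Icc x 1, u ∈ Set.Icc (-1 : ℝ) 1 := fun u hu =>
    ⟨by linarith [hu.1, hx.1], hu.2⟩
  have hxm : x ∈ Set.Icc (-1 : ℝ) 1 := Set.Ioo_subset_Icc_self hx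
  obtain ⟨I₁, b₁, t₁⟩ := one_sided_limit hx hδ hδ2 (hcont.mono hpos)
    (fun u hu => (hA u (hpos u hu) x hxm).trans_eq (by rw [abs_of_nonneg (sub_nonneg.2 hu.1)]))
    (fun u hu => hB u (hpos u hu) x hxm)
  obtain ⟨I₂, b₂, t₂⟩ := one_sided_limit (e := fun u => e (-u)) (A := A) (B := B) hx' hδ hδ2
    (hcont.comp continuousOn_neg hneg)
    (fun u hu => by
      rw [neg_neg]
      refine (hA (-u) (hneg u hu) x hxm).trans_eq ?_
      rw [abs_of_nonpos (by linarith [hu.1])]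
      ring)
    (fun u hu => by rw [neg_neg]; exact hB (-u) (hneg u hu) x hxm)
  refine ⟨I₁ - I₂, ?_, ?_⟩
  · have t := t₁.sub t₂
    rw [neg_neg, neg_sq, add_sub_add_right_eq_sub] at t
    refine t.congr fun ε => ?_
    have hr : ∫ u in -x + ε..1, e (-u) / (√(1 - u ^ 2) * (u - -x)) =
        -∫ u in (-1 : ℝ)..(x - ε), e u / (√(1 - u ^ 2) * (u - x)) := by
      have := intervalIntegral.integral_comp_neg (a := -x + ε) (b := 1)
        (fun u => -(e u / (√(1 - u ^ 2) * (u - x))))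
      rw [neg_add, neg_neg, ← sub_eq_add_neg] at this
      rw [← intervalIntegral.integral_neg, ← this]
      congr 1
      ext u
      rw [neg_sq, ← div_neg, ← mul_neg]
      congr 2
      ring
    rw [hr]
    ring
  · rw [neg_sq] at b₂
    rw [mul_sub]
    linarith [abs_sub (√(1 - x ^ 2) * I₁) (√(1 - x ^ 2) * I₂)]

/-- On a single grid cell the error of linear interpolation of a `C^{1,α}` function is Lipschitz with
constant `K * h ^ α` and bounded by `K * h ^ (1 + α) / 4`, where `h` bounds the cell length. -/
lemma interpolation_error_cell {a b h K α : ℝ} (hab : a < b) (hh : b - a ≤ h) (hα : 0 < α)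
    {f S g : ℝ → ℝ} (hg : ∀ u ∈ Set.Icc a b, HasDerivWithinAt f (g u) (Set.Icc a b) u)
    (hK : ∀ u ∈ Set.Icc a b, ∀ v ∈ Set.Icc a b, |g u - g v| ≤ K * |u - v| ^ α)
    (hS : ∀ u ∈ Set.Icc a b, S u = ((b - u) * f a + (u - a) * f b) / (b - a)) :
    (∀ u ∈ Set.Icc a b, ∀ v ∈ Set.Icc a b, |(f u - S u) - (f v - S v)| ≤ K * h ^ α * |u - v|) ∧
      ∀ u ∈ Set.Icc a b, |f u - S u| ≤ K * h ^ α * h / 4 := by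
  have hba : 0 < b - a := sub_pos.2 hab
  have hla : a ∈ Set.Icc a b := Set.left_mem_Icc.2 hab.le
  have hlb : b ∈ Set.Icc a b := Set.right_mem_Icc.2 hab.le
  have hK0 : 0 ≤ K := by
    refine nonneg_of_mul_nonneg_left ((abs_nonneg _).trans (hK b hlb a hla)) ?_
    rw [abs_of_pos hba]
    positivity
  have hKh : ∀ u ∈ Set.Icc a b, ∀ v ∈ Set.Icc a b, |g u - g v| ≤ K * h ^ α := by
    intro u hu v hv
    refine (hK u hu v hv).trans ?_
    gcongr
    exact (abs_sub_le_iff.2 ⟨by linarith [hu.2, hv.1], by linarith [hu.1, hv.2]⟩ :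
      |u - v| ≤ b - a).trans hh
  have hcont : ContinuousOn f (Set.Icc a b) := fun u hu => (hg u hu).continuousWithinAt
  have hder : ∀ u ∈ Set.Ioo a b, HasDerivAt f (g u) u := fun u hu =>
    (hg u (Set.Ioo_subset_Icc_self hu)).hasDerivAt (Icc_mem_nhds hu.1 hu.2)
  have hL0 : 0 ≤ K * h ^ α := by
    have : 0 < h := hba.trans_le hh
    positivity
  constructor
  · obtain ⟨ξ, hξ, hm⟩ := exists_hasDerivAt_eq_slope f g hab hcont hder
    have hSd : ∀ u ∈ Set.Icc a b, f u - S u = f u - (f a + (u - a) * g ξ) := by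
      intro u hu
      rw [hS u hu, hm]
      field_simp
      ring
    intro u hu v hv
    have hd : ∀ w ∈ Set.Icc a b,
        HasDerivWithinAt (fun w => f w - (f a + (w - a) * g ξ)) (g w - g ξ) (Set.Icc a b) w := by
      intro w hw
      have d := (((hasDerivAt_id w).sub_const a).mul_const (g ξ)).const_add (f a)
      rw [one_mul] at d
      exact (hg w hw).sub d.hasDerivWithinAt
    rw [hSd u hu, hSd v hv]
    exact (convex_Icc a b).norm_image_sub_le_of_norm_hasDerivWithin_le hd
      (fun w hw => hKh w hw ξ (Set.Ioo_subset_Icc_self hξ)) hv hu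
  · intro u hu
    have h0 : 0 ≤ K * h ^ α * h / 4 := by
      have : 0 < h := hba.trans_le hh
      positivity
    rcases hu.1.eq_or_lt with rfl | hau
    · rw [hS a hu, sub_self, zero_mul, add_zero, mul_div_cancel_left₀ _ hba.ne', sub_self, abs_zero]
      exact h0
    rcases hu.2.eq_or_lt with rfl | hub
    · rw [hS u hu, sub_self, zero_mul, zero_add, mul_div_cancel_left₀ _ hba.ne', sub_self, abs_zero]
      exact h0
    obtain ⟨ξ, hξ, hm⟩ := exists_hasDerivAt_eq_slope f g hau
      (hcont.mono (Set.Icc_subset_Icc_right hub.le)) fun w hw => hder w ⟨hw.1, hw.2.trans hub⟩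
    obtain ⟨η, hη, hn⟩ := exists_hasDerivAt_eq_slope f g hub
      (hcont.mono (Set.Icc_subset_Icc_left hau.le)) fun w hw => hder w ⟨hau.trans hw.1, hw.2⟩
    have hua : 0 < u - a := sub_pos.2 hau
    have hbu : 0 < b - u := sub_pos.2 hub
    have heq : f u - S u = (b - u) * (u - a) / (b - a) * (g ξ - g η) := by
      rw [hS u hu, hm, hn]
      field_simp
      ring
    have hq : (b - u) * (u - a) / (b - a) ≤ h / 4 := by
      rw [div_le_iff₀ hba]
      nlinarith [sq_nonneg ((b - u) - (u - a))]
    rw [heq, abs_mul, abs_of_nonneg (by positivity)]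
    calc _ ≤ h / 4 * (K * h ^ α) := by
          refine mul_le_mul hq ?_ (abs_nonneg _) ((by positivity : (0 : ℝ) ≤ _).trans hq)
          exact hKh ξ ⟨hξ.1.le, (hξ.2.trans hub).le⟩ η ⟨(hau.trans hη.1).le, hη.2.le⟩
      _ = _ := by ring

/-- Lipschitz bounds on consecutive cells of a grid glue to a global one. -/
lemma abs_sub_le_of_cells {t : ℕ → ℝ} {e : ℝ → ℝ} {L : ℝ} (n : ℕ)
    (hmono : ∀ k, k < n → t k < t (k + 1))
    (hL : ∀ k, k < n → ∀ u ∈ Set.Icc (t k) (t (k + 1)), ∀ v ∈ Set.Icc (t k) (t (k + 1)),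
      |e u - e v| ≤ L * |u - v|) :
    t 0 ≤ t n ∧ ∀ u ∈ Set.Icc (t 0) (t n), ∀ v ∈ Set.Icc (t 0) (t n), |e u - e v| ≤ L * |u - v| := by
  induction n with
  | zero =>
    refine ⟨le_rfl, fun u hu v hv => ?_⟩
    rw [Set.Icc_self, Set.mem_singleton_iff] at hu hv
    simp [hu, hv]
  | succ n ih =>
    obtain ⟨h0, ih⟩ := ih (fun k hk => hmono k (by omega)) fun k hk => hL k (by omega)
    have hn := hmono n (by omega)
    have hLn := hL n (by omega)
    have hcross : ∀ u ∈ Set.Icc (t 0) (t n), ∀ v ∈ Set.Icc (t n) (t (n + 1)),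
        |e u - e v| ≤ L * |u - v| := by
      intro u hu v hv
      calc |e u - e v| ≤ |e u - e (t n)| + |e (t n) - e v| := abs_sub_le _ _ _
        _ ≤ L * |u - t n| + L * |t n - v| :=
          add_le_add (ih u hu _ ⟨h0, le_rfl⟩) (hLn _ ⟨le_rfl, hn.le⟩ v hv)
        _ = L * |u - v| := by
          rw [abs_of_nonpos (sub_nonpos.2 hu.2), abs_of_nonpos (sub_nonpos.2 hv.1),
            abs_of_nonpos (sub_nonpos.2 (hu.2.trans hv.1))]
          ring
    refine ⟨h0.trans hn.le, fun u hu v hv => ?_⟩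
    rcases le_total u (t n) with h | h <;> rcases le_total v (t n) with h' | h'
    · exact ih u ⟨hu.1, h⟩ v ⟨hv.1, h'⟩
    · exact hcross u ⟨hu.1, h⟩ v ⟨h', hv.2⟩
    · rw [abs_sub_comm, abs_sub_comm u]
      exact hcross v ⟨hv.1, h'⟩ u ⟨h, hu.2⟩
    · exact hLn u ⟨h, hu.2⟩ v ⟨h', hv.2⟩

lemma exists_cell {t : ℕ → ℝ} {u : ℝ} (n : ℕ) (hn : 0 < n) (hu : u ∈ Set.Icc (t 0) (t n)) :
    ∃ k < n, u ∈ Set.Icc (t k) (t (k + 1)) := by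
  induction n with
  | zero => exact absurd hn (lt_irrefl 0)
  | succ n ih =>
    rcases le_total (t n) u with h | h
    · exact ⟨n, by omega, h, hu.2⟩
    · rcases Nat.eq_zero_or_pos n with rfl | hn'
      · exact ⟨0, by omega, hu.1, hu.2⟩
      · obtain ⟨k, hk, hk'⟩ := ih hn' ⟨hu.1, h⟩
        exact ⟨k, by omega, hk'⟩

lemma two_add_log_le {N h : ℝ} (hN : 3 ≤ N) (hh : 0 < h) :
    2 + log (4 / h) ≤ 2 * log N + π * √2 / (h * N) := by
  have hN0 : 0 < N := by linarith
  have hs : (1.4 : ℝ) < √2 := Real.lt_sqrt_of_sq_lt (by norm_num)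
  have hpi := Real.pi_gt_three
  have he := Real.exp_one_lt_d9
  have h1 := Real.log_le_sub_one_of_pos (show 0 < π * √2 / (h * N) by positivity)
  have h2 : log (4 * exp 1) ≤ log (N * (π * √2)) := by
    refine Real.log_le_log (by positivity) ?_
    have a1 : (4.2 : ℝ) ≤ π * √2 := by nlinarith
    have a2 : 3 * 4.2 ≤ N * (π * √2) := mul_le_mul hN a1 (by norm_num) hN0.le
    linarith
  rw [Real.log_mul (by norm_num) (Real.exp_pos 1).ne', Real.log_exp,
    Real.log_mul hN0.ne' (by positivity)] at h2
  rw [Real.log_div (by positivity) (by positivity), Real.log_mul hh.ne' hN0.ne'] at h1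
  rw [Real.log_div (by norm_num) hh.ne']
  linarith

open Real MeasureTheory Filter Topology

theorem quadrature_error_CC1alpha_table1
    (N : ℕ) (hN : 3 ≤ N)
    (t : ℕ → ℝ) (ht0 : t 0 = -1) (htN : t N = 1)
    (hmono : ∀ k, k < N → t k < t (k + 1))
    (γ : ℝ) (hγ : 0 < γ)
    (hstep : ∀ k, k < N → t (k + 1) - t k ≤ γ / N)
    (f S : ℝ → ℝ) (K₁ α : ℝ) (hα : 0 < α) (hα1 : α ≤ 1)
    (hfc : ContinuousOn f (Set.Icc (-1 : ℝ) 1))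
    (hf : ∀ k, k < N → ∃ g : ℝ → ℝ,
      (∀ u ∈ Set.Icc (t k) (t (k + 1)),
        HasDerivWithinAt f (g u) (Set.Icc (t k) (t (k + 1))) u) ∧
      (∀ u ∈ Set.Icc (t k) (t (k + 1)), ∀ v ∈ Set.Icc (t k) (t (k + 1)),
        |g u - g v| ≤ K₁ * |u - v| ^ α))
    (hS : ∀ k, k < N → ∀ u ∈ Set.Icc (t k) (t (k + 1)),
      S u = ((t (k + 1) - u) * f (t k) + (u - t k) * f (t (k + 1))) / (t (k + 1) - t k))
    (x : ℝ) (hx : x ∈ Set.Ioo (-1 : ℝ) 1) :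
    ∃ I : ℝ,
      Tendsto (fun ε : ℝ =>
          (∫ u in (-1 : ℝ)..(x - ε), (f u - S u) / (Real.sqrt (1 - u ^ 2) * (u - x))) +
          ∫ u in (x + ε)..(1 : ℝ), (f u - S u) / (Real.sqrt (1 - u ^ 2) * (u - x)))
        (𝓝[>] (0 : ℝ)) (𝓝 I) ∧
      |Real.sqrt (1 - x ^ 2) / π * I| ≤
        (2 * γ ^ (1 + α) * K₁ / π) * (1 + π * Real.sqrt 2 / (2 * γ * Real.log N)) *
          Real.log N / (N : ℝ) ^ (1 + α) := by
  have hN0 : (0 : ℝ) < N := by exact_mod_cast (by omega : 0 < N)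
  have hN3 : (3 : ℝ) ≤ N := by exact_mod_cast hN
  have hlog : 0 < log (N : ℝ) := Real.log_pos (by linarith)
  have hy : 0 < γ / N := by positivity
  set y := γ / N with hydef
  set h := min y 2 with hhdef
  have hh : 0 < h := lt_min hy two_pos
  have hmem : ∀ n ≤ N, -1 ≤ t n ∧ t n ≤ 1 := by
    have hm : ∀ i j, i ≤ j → j ≤ N → t i ≤ t j := by
      intro i j hij
      induction j, hij using Nat.le_induction with
      | base => exact fun _ => le_rfl
      | succ j _ ih => exact fun hj => (ih (by omega)).trans (hmono j (by omega)).le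
    exact fun n hn => ⟨ht0 ▸ hm 0 n (Nat.zero_le n) hn, htN ▸ hm n N hn le_rfl⟩
  have hcell : ∀ k, k < N →
      (∀ u ∈ Set.Icc (t k) (t (k + 1)), ∀ v ∈ Set.Icc (t k) (t (k + 1)),
        |(f u - S u) - (f v - S v)| ≤ K₁ * h ^ α * |u - v|) ∧
      ∀ u ∈ Set.Icc (t k) (t (k + 1)), |f u - S u| ≤ K₁ * h ^ α * h / 4 := by
    intro k hk
    obtain ⟨g, hg, hgK⟩ := hf k hk
    refine interpolation_error_cell (hmono k hk) (le_min (hstep k hk) ?_) hα hg hgK (hS k hk)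
    linarith [(hmem k hk.le).1, (hmem (k + 1) hk).2]
  have hA := (abs_sub_le_of_cells (e := fun u => f u - S u) N hmono fun k hk => (hcell k hk).1).2
  have hM : ∀ u ∈ Set.Icc (t 0) (t N), |f u - S u| ≤ K₁ * h ^ α * h / 4 := by
    intro u hu
    obtain ⟨k, hk, hku⟩ := exists_cell N (by omega) hu
    exact (hcell k hk).2 u hku
  rw [ht0, htN] at hA hM
  have hK0 : 0 ≤ K₁ := by
    have h1 := (abs_nonneg _).trans (hM 1 (by norm_num))
    have h2 : 0 ≤ K₁ * (h ^ α * h / 4) := by linarith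
    exact nonneg_of_mul_nonneg_left h2 (by positivity)
  obtain ⟨I, hI, hb⟩ := principal_value_bound (e := fun u => f u - S u) (δ := h / 2)
    (B := K₁ * h ^ α * h / 2) hx
    (by positivity) (by linarith [min_le_right y 2]) hA (fun u hu v hv => by
      have h1 := abs_sub (f u - S u) (f v - S v)
      linarith [hM u hu, hM v hv])
  refine ⟨I, hI, ?_⟩
  have hb' : |√(1 - x ^ 2) * I| ≤ K₁ * y ^ α * (y * (2 * log N) + π * √2 / N) := by
    have h4 : (2 : ℝ) / (h / 2) = 4 / h := by field_simp; norm_num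
    rw [h4] at hb
    calc _ ≤ _ := hb
      _ = K₁ * h ^ α * h * (2 + log (4 / h)) := by ring
      _ ≤ K₁ * h ^ α * h * (2 * log N + π * √2 / (h * N)) := by
        exact mul_le_mul_of_nonneg_left (two_add_log_le hN3 hh) (by positivity)
      _ = K₁ * h ^ α * (h * (2 * log N) + π * √2 / N) := by field_simp
      _ ≤ _ := by
        have : h ≤ y := min_le_left y 2
        gcongr
  calc |√(1 - x ^ 2) / π * I| = |√(1 - x ^ 2) * I| / π := by
        rw [div_mul_eq_mul_div, abs_div, abs_of_pos Real.pi_pos]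
    _ ≤ K₁ * y ^ α * (y * (2 * log N) + π * √2 / N) / π := by gcongr
    _ = _ := by
      rw [hydef, Real.div_rpow hγ.le hN0.le, Real.rpow_add hγ, Real.rpow_add hN0, Real.rpow_one,
        Real.rpow_one]
      field_simp
end

section
/- Let f belong to H^α([−1,1],K). Then for every x ∈ (−1,1) the Cauchy principal value R_N(f,x) = J(f − S_N, x) exists and satisfies |R_N(f,x)| ≤ (2^{2−α}γ^α K/π)·(1 + (2 + 1/α)·2^{2−2α}/(γ^α·ln N))·(ln N)/N^α. -/
open Real MeasureTheory Filter Topology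

theorem abs_affine_interp_sub_le {α K a b A B Y c u : ℝ} (hα : 0 < α) (hα1 : α ≤ 1) (hK : 0 ≤ K)
    (hab : a < b) (hu : u ∈ Set.Icc a b) (hc : c ≤ a ∨ b ≤ c)
    (hA : |A - Y| ≤ K * |a - c| ^ α) (hB : |B - Y| ≤ K * |b - c| ^ α) :
    |((b - u) * A + (u - a) * B) / (b - a) - Y| ≤ K * |u - c| ^ α := by
  obtain ⟨h1, h2⟩ := hu
  have hd : 0 < b - a := by linarith
  set p := (b - u) / (b - a) with hp
  set q := (u - a) / (b - a) with hq
  have hp0 : 0 ≤ p := div_nonneg (by linarith) hd.le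
  have hq0 : 0 ≤ q := div_nonneg (by linarith) hd.le
  have hpq : p + q = 1 := by rw [hp, hq]; field_simp; ring
  have hu' : u = p * a + q * b := by rw [hp, hq]; field_simp; ring
  have e1 : ((b - u) * A + (u - a) * B) / (b - a) - Y = p * (A - Y) + q * (B - Y) := by
    rw [hp, hq]; field_simp; ring
  have e2 : |u - c| = p * |a - c| + q * |b - c| := by
    rcases hc with hc | hc
    · rw [abs_of_nonneg (by linarith), abs_of_nonneg (by linarith), abs_of_nonneg (by linarith)]
      linear_combination hu' + c * hpq
    · rw [abs_of_nonpos (by linarith), abs_of_nonpos (by linarith), abs_of_nonpos (by linarith)]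
      linear_combination - hu' - c * hpq
  have conc := (Real.concaveOn_rpow hα.le hα1).2 (x := |a - c|) (y := |b - c|)
    (Set.mem_Ici.2 (abs_nonneg _)) (Set.mem_Ici.2 (abs_nonneg _)) hp0 hq0 hpq
  simp only [smul_eq_mul] at conc
  rw [e1, e2]
  calc |p * (A - Y) + q * (B - Y)| ≤ |p * (A - Y)| + |q * (B - Y)| := abs_add_le _ _
    _ = p * |A - Y| + q * |B - Y| := by rw [abs_mul, abs_mul, abs_of_nonneg hp0, abs_of_nonneg hq0]
    _ ≤ p * (K * |a - c| ^ α) + q * (K * |b - c| ^ α) := by gcongr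
    _ = K * (p * |a - c| ^ α + q * |b - c| ^ α) := by ring
    _ ≤ _ := by gcongr

theorem abs_affine_interp_sub_self_le {α K a b A B Y u : ℝ} (hα : 0 < α) (hα1 : α ≤ 1) (hK : 0 ≤ K)
    (hab : a < b) (hu : u ∈ Set.Icc a b)
    (hA : |Y - A| ≤ K * |u - a| ^ α) (hB : |Y - B| ≤ K * |u - b| ^ α) :
    |Y - ((b - u) * A + (u - a) * B) / (b - a)| ≤ K * ((b - a) / 2) ^ α := by
  obtain ⟨h1, h2⟩ := hu
  have hd : 0 < b - a := by linarith
  set p := (b - u) / (b - a) with hp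
  set q := (u - a) / (b - a) with hq
  have hp0 : 0 ≤ p := div_nonneg (by linarith) hd.le
  have hq0 : 0 ≤ q := div_nonneg (by linarith) hd.le
  have hpq : p + q = 1 := by rw [hp, hq]; field_simp; ring
  have e1 : Y - ((b - u) * A + (u - a) * B) / (b - a) = p * (Y - A) + q * (Y - B) := by
    rw [hp, hq]; field_simp; ring
  have ea : |u - a| = q * (b - a) := by
    rw [abs_of_nonneg (by linarith), hq]; field_simp
  have eb : |u - b| = p * (b - a) := by
    rw [abs_of_nonpos (by linarith), hp]; field_simp; ring
  have conc := (Real.concaveOn_rpow hα.le hα1).2 (x := |u - a|) (y := |u - b|)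
    (Set.mem_Ici.2 (abs_nonneg _)) (Set.mem_Ici.2 (abs_nonneg _)) hp0 hq0 hpq
  simp only [smul_eq_mul] at conc
  have e3 : p * |u - a| + q * |u - b| ≤ (b - a) / 2 := by
    rw [ea, eb]
    have : p = 1 - q := by linarith
    rw [this]
    nlinarith [mul_nonneg hd.le (sq_nonneg (1 - 2 * q))]
  rw [e1]
  calc |p * (Y - A) + q * (Y - B)| ≤ |p * (Y - A)| + |q * (Y - B)| := abs_add_le _ _
    _ = p * |Y - A| + q * |Y - B| := by rw [abs_mul, abs_mul, abs_of_nonneg hp0, abs_of_nonneg hq0]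
    _ ≤ p * (K * |u - a| ^ α) + q * (K * |u - b| ^ α) := by gcongr
    _ = K * (p * |u - a| ^ α + q * |u - b| ^ α) := by ring
    _ ≤ K * (p * |u - a| + q * |u - b|) ^ α := by gcongr
    _ ≤ _ := by gcongr

theorem abs_affine_interp_sub_interp_le {α K a b A B u v : ℝ} (hα1 : α ≤ 1)
    (hab : a < b) (hu : u ∈ Set.Icc a b) (hv : v ∈ Set.Icc a b)
    (hAB : |B - A| ≤ K * |b - a| ^ α) :
    |((b - u) * A + (u - a) * B) / (b - a) - ((b - v) * A + (v - a) * B) / (b - a)|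
      ≤ K * |u - v| ^ α := by
  have hd : 0 < b - a := by linarith
  have e1 : ((b - u) * A + (u - a) * B) / (b - a) - ((b - v) * A + (v - a) * B) / (b - a)
      = (u - v) / (b - a) * (B - A) := by field_simp; ring
  have hle : |u - v| / (b - a) ≤ 1 := by
    rw [div_le_one hd, abs_le]; constructor <;> linarith [hu.1, hu.2, hv.1, hv.2]
  have h0 : 0 ≤ |u - v| / (b - a) := by positivity
  rw [e1, abs_mul, abs_div, abs_of_pos hd]
  rw [abs_of_pos hd] at hAB
  calc |u - v| / (b - a) * |B - A|
      ≤ (|u - v| / (b - a)) ^ α * (K * (b - a) ^ α) := by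
        gcongr
        exact Real.self_le_rpow_of_le_one h0 hle hα1
    _ = K * |u - v| ^ α := by
        rw [Real.div_rpow (abs_nonneg _) hd.le]
        have := (Real.rpow_pos_of_pos hd α).ne'
        field_simp

theorem exists_mem_Icc_grid {N : ℕ} {t : ℕ → ℝ} (hN : 0 < N)
    (u : ℝ) (hu : u ∈ Set.Icc (t 0) (t N)) : ∃ k < N, u ∈ Set.Icc (t k) (t (k + 1)) := by
  induction N with
  | zero => omega
  | succ n ih =>
    rcases le_total (t n) u with h | h
    · exact ⟨n, by omega, h, hu.2⟩
    · rcases Nat.eq_zero_or_pos n with rfl | hn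
      · exact ⟨0, by omega, hu⟩
      · obtain ⟨k, hk, hk'⟩ := ih hn ⟨hu.1, h⟩
        exact ⟨k, by omega, hk'⟩

theorem grid_mono {N : ℕ} {t : ℕ → ℝ} (hmono : ∀ k, k < N → t k < t (k + 1))
    {i j : ℕ} (hij : i ≤ j) (hj : j ≤ N) : t i ≤ t j := by
  induction j, hij using Nat.le_induction with
  | base => exact le_rfl
  | succ j hij ih => exact (ih (by omega)).trans (hmono j (by omega)).le

section Spline

variable {N : ℕ} {t : ℕ → ℝ} {f S : ℝ → ℝ} {K α : ℝ}

theorem abs_sub_linear_spline_le (hN : 0 < N) (hmono : ∀ k, k < N → t k < t (k + 1))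
    (hα : 0 < α) (hα1 : α ≤ 1) (hK : 0 ≤ K) {h : ℝ} (hstep : ∀ k, k < N → t (k + 1) - t k ≤ h)
    (hf : ∀ u ∈ Set.Icc (t 0) (t N), ∀ v ∈ Set.Icc (t 0) (t N), |f u - f v| ≤ K * |u - v| ^ α)
    (hS : ∀ k, k < N → ∀ u ∈ Set.Icc (t k) (t (k + 1)),
      S u = ((t (k + 1) - u) * f (t k) + (u - t k) * f (t (k + 1))) / (t (k + 1) - t k))
    {u : ℝ} (hu : u ∈ Set.Icc (t 0) (t N)) : |f u - S u| ≤ K * (h / 2) ^ α := by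
  obtain ⟨k, hk, hku⟩ := exists_mem_Icc_grid hN u hu
  have hd := hmono k hk
  have hnode : ∀ j ≤ N, t j ∈ Set.Icc (t 0) (t N) := fun j hj =>
    ⟨grid_mono hmono (Nat.zero_le j) hj, grid_mono hmono hj le_rfl⟩
  rw [hS k hk u hku]
  refine (abs_affine_interp_sub_self_le hα hα1 hK hd hku (hf u hu _ (hnode k hk.le))
    (hf u hu _ (hnode (k + 1) hk))).trans ?_
  have := hstep k hk
  have h0 : 0 ≤ (t (k + 1) - t k) / 2 := by linarith
  gcongr

theorem linear_spline_holder (hN : 0 < N) (hmono : ∀ k, k < N → t k < t (k + 1))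
    (hα : 0 < α) (hα1 : α ≤ 1) (hK : 0 ≤ K)
    (hf : ∀ u ∈ Set.Icc (t 0) (t N), ∀ v ∈ Set.Icc (t 0) (t N), |f u - f v| ≤ K * |u - v| ^ α)
    (hS : ∀ k, k < N → ∀ u ∈ Set.Icc (t k) (t (k + 1)),
      S u = ((t (k + 1) - u) * f (t k) + (u - t k) * f (t (k + 1))) / (t (k + 1) - t k))
    {u v : ℝ} (hu : u ∈ Set.Icc (t 0) (t N)) (hv : v ∈ Set.Icc (t 0) (t N)) :
    |S u - S v| ≤ K * |u - v| ^ α := by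
  have hnode : ∀ j ≤ N, t j ∈ Set.Icc (t 0) (t N) := fun j hj =>
    ⟨grid_mono hmono (Nat.zero_le j) hj, grid_mono hmono hj le_rfl⟩
  have hSnode : ∀ j ≤ N, ∀ w ∈ Set.Icc (t 0) (t N), |S w - f (t j)| ≤ K * |w - t j| ^ α := by
    intro j hj w hw
    obtain ⟨k, hk, hkw⟩ := exists_mem_Icc_grid hN w hw
    rw [hS k hk w hkw]
    refine abs_affine_interp_sub_le hα hα1 hK (hmono k hk) hkw ?_
      (hf _ (hnode k hk.le) _ (hnode j hj)) (hf _ (hnode (k + 1) hk) _ (hnode j hj))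
    rcases le_or_gt j k with h | h
    · exact Or.inl (grid_mono hmono h hk.le)
    · exact Or.inr (grid_mono hmono h hj)
  obtain ⟨k, hk, hku⟩ := exists_mem_Icc_grid hN u hu
  obtain ⟨l, hl, hlv⟩ := exists_mem_Icc_grid hN v hv
  rcases eq_or_ne k l with rfl | hkl
  · rw [hS k hk u hku, hS k hk v hlv]
    exact abs_affine_interp_sub_interp_le hα1 (hmono k hk) hku hlv
      (hf _ (hnode (k + 1) hk) _ (hnode k hk.le))
  · rw [hS k hk u hku]
    refine abs_affine_interp_sub_le hα hα1 hK (hmono k hk) hku ?_ ?_ ?_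
    · rcases lt_or_gt_of_ne hkl with h | h
      · exact Or.inr ((grid_mono hmono h hl.le).trans hlv.1)
      · exact Or.inl (hlv.2.trans (grid_mono hmono h hk.le))
    · rw [abs_sub_comm, abs_sub_comm (t k)]; exact hSnode k hk.le v hv
    · rw [abs_sub_comm, abs_sub_comm (t (k + 1))]; exact hSnode (k + 1) hk v hv

end Spline

/-- On `[0, π] \ {φ}` this is a primitive of `θ ↦ sin φ / (cos θ - cos φ)`. -/
noncomputable def cosKernelPrimitive (φ θ : ℝ) : ℝ :=
  log (sin ((φ + θ) / 2)) - log (sin ((φ - θ) / 2))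

theorem cos_sub_cos_eq_two_mul (φ θ : ℝ) :
    cos θ - cos φ = 2 * sin ((φ + θ) / 2) * sin ((φ - θ) / 2) := by
  rw [cos_sub_cos, show (θ - φ) / 2 = -((φ - θ) / 2) by ring, sin_neg, add_comm θ φ]; ring

theorem sin_half_add_pos {φ θ : ℝ} (hφ : φ ∈ Set.Ioo 0 π) (hθ : θ ∈ Set.Icc 0 π) :
    0 < sin ((φ + θ) / 2) :=
  sin_pos_of_pos_of_lt_pi (by linarith [hφ.1, hθ.1]) (by linarith [hφ.2, hθ.2])

theorem sin_half_sub_ne_zero {φ θ : ℝ} (hφ : φ ∈ Set.Ioo 0 π) (hθ : θ ∈ Set.Icc 0 π)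
    (hne : θ ≠ φ) : sin ((φ - θ) / 2) ≠ 0 := by
  rcases lt_or_gt_of_ne hne with h | h
  · exact (sin_pos_of_pos_of_lt_pi (by linarith) (by linarith [hφ.2, hθ.1, pi_pos])).ne'
  · exact (sin_neg_of_neg_of_neg_pi_lt (by linarith) (by linarith [hφ.1, hθ.2, pi_pos])).ne

theorem cos_sub_cos_ne_zero {φ θ : ℝ} (hφ : φ ∈ Set.Ioo 0 π) (hθ : θ ∈ Set.Icc 0 π)
    (hne : θ ≠ φ) : cos θ - cos φ ≠ 0 := by
  rw [cos_sub_cos_eq_two_mul]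
  exact mul_ne_zero (mul_ne_zero two_ne_zero (sin_half_add_pos hφ hθ).ne')
    (sin_half_sub_ne_zero hφ hθ hne)

theorem hasDerivAt_cosKernelPrimitive {φ θ : ℝ} (hφ : φ ∈ Set.Ioo 0 π) (hθ : θ ∈ Set.Icc 0 π)
    (hne : θ ≠ φ) :
    HasDerivAt (cosKernelPrimitive φ) (sin φ / (cos θ - cos φ)) θ := by
  have hA := (sin_half_add_pos hφ hθ).ne'
  have hB := sin_half_sub_ne_zero hφ hθ hne
  have h1 := ((((hasDerivAt_id' θ).const_add φ).div_const 2).sin.log hA).sub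
    ((((hasDerivAt_id' θ).const_sub φ).div_const 2).sin.log hB)
  refine h1.congr_deriv ?_
  rw [cos_sub_cos_eq_two_mul]
  have hs : sin φ = sin ((φ + θ) / 2) * cos ((φ - θ) / 2) + cos ((φ + θ) / 2) * sin ((φ - θ) / 2) := by
    rw [← sin_add]; congr 1; ring
  rw [hs]
  field_simp
  ring

theorem cosKernelPrimitive_zero (φ : ℝ) : cosKernelPrimitive φ 0 = 0 := by
  simp [cosKernelPrimitive]

theorem cosKernelPrimitive_pi (φ : ℝ) : cosKernelPrimitive φ π = 0 := by
  rw [cosKernelPrimitive, show (φ + π) / 2 = φ / 2 + π / 2 by ring,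
    show (φ - π) / 2 = φ / 2 - π / 2 by ring, sin_add_pi_div_two, sin_sub_pi_div_two,
    log_neg_eq_log, sub_self]

theorem abs_sub_div_pi_le_abs_sin {φ θ : ℝ} (h : |φ - θ| ≤ π) :
    |φ - θ| / π ≤ |sin ((φ - θ) / 2)| := by
  have h3 : |sin ((φ - θ) / 2)| = sin (|φ - θ| / 2) := by
    rcases le_total 0 (φ - θ) with h0 | h0
    · rw [abs_of_nonneg h0] at h ⊢
      exact abs_of_nonneg (sin_nonneg_of_nonneg_of_le_pi (by linarith) (by linarith [pi_pos]))
    · rw [abs_of_nonpos h0] at h ⊢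
      rw [abs_of_nonpos, ← sin_neg]
      · congr 1; ring
      · exact sin_nonpos_of_nonpos_of_neg_pi_le (by linarith) (by linarith [pi_pos])
  rw [h3]
  refine le_trans (le_of_eq ?_) (mul_le_sin (by positivity) (by linarith))
  ring

theorem abs_sub_le_pi {φ θ : ℝ} (hφ : φ ∈ Set.Ioo 0 π) (hθ : θ ∈ Set.Icc 0 π) : |φ - θ| ≤ π :=
  abs_le.2 ⟨by linarith [hφ.1, hθ.2], by linarith [hφ.2, hθ.1]⟩

theorem cosKernelPrimitive_le {φ θ : ℝ} (hφ : φ ∈ Set.Ioo 0 π) (hθ : θ ∈ Set.Icc 0 π)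
    {η : ℝ} (hη : 0 < η) (h : π * η ≤ |φ - θ|) : cosKernelPrimitive φ θ ≤ - log η := by
  have h1 : log (sin ((φ + θ) / 2)) ≤ 0 :=
    log_nonpos (sin_half_add_pos hφ hθ).le (sin_le_one _)
  have h2 : η ≤ |sin ((φ - θ) / 2)| :=
    ((le_div_iff₀' pi_pos).2 h).trans (abs_sub_div_pi_le_abs_sin (abs_sub_le_pi hφ hθ))
  have h5 := log_le_log hη h2
  rw [log_abs] at h5
  rw [cosKernelPrimitive]
  linarith

section Kernel

variable {φ c d : ℝ}

theorem continuousOn_cosKernel (hφ : φ ∈ Set.Ioo 0 π) (hcd : c ≤ d)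
    (hsub : Set.Icc c d ⊆ Set.Icc 0 π) (hmem : φ ∉ Set.Icc c d) {g : ℝ → ℝ}
    (hg : ContinuousOn g (Set.Icc 0 π)) :
    ContinuousOn (fun θ => g θ / (cos θ - cos φ)) (Set.uIcc c d) := by
  rw [Set.uIcc_of_le hcd]
  refine (hg.mono hsub).div (by fun_prop) fun θ hθ => ?_
  exact cos_sub_cos_ne_zero hφ (hsub hθ) fun h => hmem (h ▸ hθ)

theorem integral_cosKernel (hφ : φ ∈ Set.Ioo 0 π) (hcd : c ≤ d)
    (hsub : Set.Icc c d ⊆ Set.Icc 0 π) (hmem : φ ∉ Set.Icc c d) :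
    ∫ θ in c..d, sin φ / (cos θ - cos φ) = cosKernelPrimitive φ d - cosKernelPrimitive φ c := by
  refine intervalIntegral.integral_eq_sub_of_hasDerivAt (fun θ hθ => ?_)
    (continuousOn_cosKernel hφ hcd hsub hmem continuousOn_const).intervalIntegrable
  rw [Set.uIcc_of_le hcd] at hθ
  exact hasDerivAt_cosKernelPrimitive hφ (hsub hθ) fun h => hmem (h ▸ hθ)

theorem integral_abs_cosKernel (hφ : φ ∈ Set.Ioo 0 π) (hcd : c ≤ d)
    (hsub : Set.Icc c d ⊆ Set.Icc 0 π) (hmem : φ ∉ Set.Icc c d) :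
    ∫ θ in c..d, |sin φ / (cos θ - cos φ)| =
      |cosKernelPrimitive φ d - cosKernelPrimitive φ c| := by
  rw [← integral_cosKernel hφ hcd hsub hmem]
  have hs : 0 ≤ sin φ := sin_nonneg_of_nonneg_of_le_pi hφ.1.le hφ.2.le
  rcases lt_or_ge d φ with h | h
  · have hk : ∀ θ ∈ Set.Icc c d, 0 ≤ sin φ / (cos θ - cos φ) := fun θ hθ =>
      div_nonneg hs (sub_nonneg.2 (cos_le_cos_of_nonneg_of_le_pi (hsub hθ).1 hφ.2.le
        (hθ.2.trans h.le)))
    rw [abs_of_nonneg (intervalIntegral.integral_nonneg hcd hk)]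
    refine intervalIntegral.integral_congr fun θ hθ => abs_of_nonneg (hk θ ?_)
    rwa [Set.uIcc_of_le hcd] at hθ
  · have hc : φ < c := lt_of_not_ge fun h' => hmem ⟨h', h⟩
    have hk : ∀ θ ∈ Set.Icc c d, sin φ / (cos θ - cos φ) ≤ 0 := fun θ hθ =>
      div_nonpos_of_nonneg_of_nonpos hs (sub_nonpos.2 (cos_le_cos_of_nonneg_of_le_pi hφ.1.le
        (hsub hθ).2 (hc.le.trans hθ.1)))
    have e : ∀ θ ∈ Set.uIcc c d, |sin φ / (cos θ - cos φ)| = -(sin φ / (cos θ - cos φ)) := by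
      intro θ hθ
      rw [Set.uIcc_of_le hcd] at hθ
      exact abs_of_nonpos (hk θ hθ)
    rw [intervalIntegral.integral_congr e, intervalIntegral.integral_neg, abs_of_nonpos]
    have := intervalIntegral.integral_nonneg (μ := volume) hcd fun θ hθ => neg_nonneg.2 (hk θ hθ)
    rw [intervalIntegral.integral_neg] at this
    linarith

variable {g : ℝ → ℝ}

theorem integral_div_cos_sub_cos (hφ : φ ∈ Set.Ioo 0 π) (hcd : c ≤ d)
    (hsub : Set.Icc c d ⊆ Set.Icc 0 π) (hmem : φ ∉ Set.Icc c d)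
    (hg : ContinuousOn g (Set.Icc 0 π)) :
    ∫ θ in c..d, g θ / (cos θ - cos φ) = (∫ θ in c..d, (g θ - g φ) / (cos θ - cos φ)) +
      g φ / sin φ * (cosKernelPrimitive φ d - cosKernelPrimitive φ c) := by
  have hs : sin φ ≠ 0 := (sin_pos_of_pos_of_lt_pi hφ.1 hφ.2).ne'
  rw [← integral_cosKernel hφ hcd hsub hmem, ← intervalIntegral.integral_const_mul,
    ← intervalIntegral.integral_add]
  · refine intervalIntegral.integral_congr fun θ _ => ?_
    field_simp
    ring
  · exact (continuousOn_cosKernel (g := fun θ => g θ - g φ) hφ hcd hsub hmem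
      (hg.sub continuousOn_const)).intervalIntegrable
  · exact ((continuousOn_cosKernel hφ hcd hsub hmem
      continuousOn_const).intervalIntegrable).const_mul _

theorem abs_integral_div_cos_sub_cos_le (hφ : φ ∈ Set.Ioo 0 π) (hcd : c ≤ d)
    (hsub : Set.Icc c d ⊆ Set.Icc 0 π) (hmem : φ ∉ Set.Icc c d)
    {M : ℝ} (hM : ∀ θ ∈ Set.Icc 0 π, |g θ| ≤ M) :
    |sin φ * ∫ θ in c..d, g θ / (cos θ - cos φ)| ≤
      M * |cosKernelPrimitive φ d - cosKernelPrimitive φ c| := by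
  rw [← integral_abs_cosKernel hφ hcd hsub hmem, ← intervalIntegral.integral_const_mul,
    ← intervalIntegral.integral_const_mul, ← Real.norm_eq_abs]
  refine intervalIntegral.norm_integral_le_of_norm_le hcd (ae_of_all _ fun θ hθ => ?_) ?_
  · rw [Real.norm_eq_abs, show sin φ * (g θ / (cos θ - cos φ)) = g θ * (sin φ / (cos θ - cos φ)) by
      ring, abs_mul]
    exact mul_le_mul_of_nonneg_right (hM θ (hsub ⟨hθ.1.le, hθ.2⟩)) (abs_nonneg _)
  · exact ((continuousOn_cosKernel hφ hcd hsub hmem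
      continuousOn_const).intervalIntegrable).abs.const_mul _

end Kernel

theorem intervalIntegrable_abs_div_pi_rpow {α : ℝ} (hα : 0 < α) {s : ℝ} (hs : 0 ≤ s) :
    IntervalIntegrable (fun y : ℝ => (|y| / π) ^ (α - 1)) volume 0 s := by
  refine IntervalIntegrable.congr (f := fun y => y ^ (α - 1) / π ^ (α - 1)) (fun y hy => ?_)
    ((intervalIntegral.intervalIntegrable_rpow' (by linarith)).div_const _)
  rw [Set.uIoc_of_le hs] at hy
  simp only [abs_of_pos hy.1, div_rpow hy.1.le pi_pos.le]

theorem integral_abs_div_pi_rpow {α : ℝ} (hα : 0 < α) {s : ℝ} (hs : 0 ≤ s) :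
    ∫ y in (0 : ℝ)..s, (|y| / π) ^ (α - 1) = π * (s / π) ^ α / α := by
  have e : ∀ y ∈ Set.uIcc 0 s, (|y| / π) ^ (α - 1) = (fun z => z ^ (α - 1)) (y / π) := by
    intro y hy
    rw [Set.uIcc_of_le hs] at hy
    simp only [abs_of_nonneg hy.1]
  rw [intervalIntegral.integral_congr e, intervalIntegral.integral_comp_div (fun z : ℝ => z ^ (α - 1)) pi_ne_zero,
    integral_rpow (Or.inl (by linarith)), zero_div, sub_add_cancel, zero_rpow hα.ne', sub_zero,
    smul_eq_mul, mul_div_assoc]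

section Holder

variable {g : ℝ → ℝ} {C α φ : ℝ}

theorem intervalIntegrable_abs_sub_div_pi_rpow (hα : 0 < α) {c d : ℝ} (hc : c ≤ φ) (hd : φ ≤ d) :
    IntervalIntegrable (fun θ : ℝ => (|φ - θ| / π) ^ (α - 1)) volume c φ ∧
      IntervalIntegrable (fun θ : ℝ => (|φ - θ| / π) ^ (α - 1)) volume φ d := by
  constructor
  · have := ((intervalIntegrable_abs_div_pi_rpow hα (sub_nonneg.2 hc)).comp_sub_left φ).symm
    simpa using this
  · have := (intervalIntegrable_abs_div_pi_rpow hα (sub_nonneg.2 hd)).comp_sub_right φ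
    simpa [abs_sub_comm] using this

theorem integral_abs_sub_div_pi_rpow (hα : 0 < α) {c d : ℝ} (hc : c ≤ φ) (hd : φ ≤ d) :
    ∫ θ in c..d, (|φ - θ| / π) ^ (α - 1) =
      π * ((φ - c) / π) ^ α / α + π * ((d - φ) / π) ^ α / α := by
  obtain ⟨h1, h2⟩ := intervalIntegrable_abs_sub_div_pi_rpow hα hc hd
  rw [← intervalIntegral.integral_add_adjacent_intervals h1 h2,
    ← integral_abs_div_pi_rpow hα (sub_nonneg.2 hc), ← integral_abs_div_pi_rpow hα (sub_nonneg.2 hd)]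
  congr 1
  · rw [intervalIntegral.integral_comp_sub_left (fun y : ℝ => (|y| / π) ^ (α - 1)) φ, sub_self]
  · simp_rw [abs_sub_comm φ]
    rw [intervalIntegral.integral_comp_sub_right (fun y : ℝ => (|y| / π) ^ (α - 1)) φ, sub_self]

theorem abs_sin_mul_slope_cos_le (hφ : φ ∈ Set.Ioo 0 π) (hα : 0 < α) (hα1 : α ≤ 1) (hC : 0 ≤ C)
    (hg : ∀ θ ∈ Set.Icc 0 π, |g θ - g φ| ≤ C * |cos θ - cos φ| ^ α)
    {θ : ℝ} (hθ : θ ∈ Set.Icc 0 π) (hne : θ ≠ φ) :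
    |sin φ * ((g θ - g φ) / (cos θ - cos φ))| ≤ C * (|φ - θ| / π) ^ (α - 1) := by
  have hs : 0 < sin φ := sin_pos_of_pos_of_lt_pi hφ.1 hφ.2
  have hy : 0 < |cos θ - cos φ| := abs_pos.2 (cos_sub_cos_ne_zero hφ hθ hne)
  have hz : 0 < |φ - θ| / π := div_pos (abs_pos.2 (sub_ne_zero.2 hne.symm)) pi_pos
  have hA : sin φ ≤ 2 * sin ((φ + θ) / 2) := by
    have h := strictConcaveOn_sin_Icc.concaveOn.2 ⟨hφ.1.le, hφ.2.le⟩ hθ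
      (by norm_num : (0 : ℝ) ≤ 1 / 2) (by norm_num : (0 : ℝ) ≤ 1 / 2) (by norm_num)
    simp only [smul_eq_mul] at h
    rw [show 1 / 2 * φ + 1 / 2 * θ = (φ + θ) / 2 by ring] at h
    linarith [sin_nonneg_of_nonneg_of_le_pi hθ.1 hθ.2]
  have hlow : sin φ * (|φ - θ| / π) ≤ |cos θ - cos φ| := by
    have hA0 : 0 < 2 * sin ((φ + θ) / 2) := by linarith
    rw [cos_sub_cos_eq_two_mul, abs_mul, abs_of_pos hA0]
    exact mul_le_mul hA (abs_sub_div_pi_le_abs_sin (abs_sub_le_pi hφ hθ)) hz.le hA0.le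
  calc |sin φ * ((g θ - g φ) / (cos θ - cos φ))|
      = sin φ * (|g θ - g φ| / |cos θ - cos φ|) := by rw [abs_mul, abs_div, abs_of_pos hs]
    _ ≤ sin φ * (C * |cos θ - cos φ| ^ α / |cos θ - cos φ|) := by gcongr; exact hg θ hθ
    _ = C * (sin φ * |cos θ - cos φ| ^ (α - 1)) := by rw [rpow_sub_one hy.ne']; ring
    _ ≤ C * (sin φ * (sin φ * (|φ - θ| / π)) ^ (α - 1)) := by
        have := rpow_le_rpow_of_nonpos (mul_pos hs hz) hlow (by linarith : α - 1 ≤ 0)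
        gcongr
    _ = C * (sin φ ^ α * (|φ - θ| / π) ^ (α - 1)) := by
        rw [mul_rpow hs.le hz.le, rpow_sub_one hs.ne']; field_simp
    _ ≤ C * (1 * (|φ - θ| / π) ^ (α - 1)) := by
        gcongr
        exact rpow_le_one hs.le (sin_le_one _) hα.le
    _ = _ := by rw [one_mul]

theorem intervalIntegrable_slope_cos (hφ : φ ∈ Set.Ioo 0 π) (hα : 0 < α) (hα1 : α ≤ 1) (hC : 0 ≤ C)
    (hg : ∀ θ ∈ Set.Icc 0 π, |g θ - g φ| ≤ C * |cos θ - cos φ| ^ α)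
    (hgc : ContinuousOn g (Set.Icc 0 π)) :
    IntervalIntegrable (fun θ => (g θ - g φ) / (cos θ - cos φ)) volume 0 π := by
  have hs : sin φ ≠ 0 := (sin_pos_of_pos_of_lt_pi hφ.1 hφ.2).ne'
  suffices h : IntervalIntegrable (fun θ => sin φ * ((g θ - g φ) / (cos θ - cos φ))) volume 0 π by
    refine (h.const_mul (sin φ)⁻¹).congr fun θ _ => ?_
    field_simp
  obtain ⟨h1, h2⟩ := intervalIntegrable_abs_sub_div_pi_rpow (α := α) hα hφ.1.le hφ.2.le
  have hne : ∀ᵐ θ : ℝ ∂(volume.restrict (Set.uIoc 0 π)), θ ≠ φ :=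
    ae_restrict_of_ae (Measure.ae_ne volume φ)
  refine ((h1.trans h2).const_mul C).mono_fun' ?_ ?_
  · have hcont : ContinuousOn (fun θ => sin φ * ((g θ - g φ) / (cos θ - cos φ)))
        (Set.Icc 0 π \ {φ}) :=
      continuousOn_const.mul (((hgc.mono Set.sdiff_subset).sub continuousOn_const).div (by fun_prop)
        fun θ hθ => cos_sub_cos_ne_zero hφ hθ.1 hθ.2)
    have := hcont.aestronglyMeasurable (μ := volume)
      (measurableSet_Icc.diff (measurableSet_singleton φ))
    refine this.mono_measure ?_ |>.congr (ae_eq_refl _)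
    rw [Set.uIoc_of_le pi_pos.le]
    refine Measure.restrict_mono_ae ?_
    filter_upwards [Measure.ae_ne volume φ] with θ hθ h
    exact ⟨⟨h.1.le, h.2⟩, hθ⟩
  · filter_upwards [hne, ae_restrict_mem measurableSet_uIoc] with θ hθ hmem
    rw [Set.uIoc_of_le pi_pos.le] at hmem
    exact abs_sin_mul_slope_cos_le hφ hα hα1 hC hg ⟨hmem.1.le, hmem.2⟩ hθ

theorem abs_sin_mul_integral_slope_cos_near_le (hφ : φ ∈ Set.Ioo 0 π) (hα : 0 < α) (hα1 : α ≤ 1)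
    (hC : 0 ≤ C) (hg : ∀ θ ∈ Set.Icc 0 π, |g θ - g φ| ≤ C * |cos θ - cos φ| ^ α)
    {c d η : ℝ} (hc0 : 0 ≤ c) (hc : c ≤ φ) (hd : φ ≤ d) (hdπ : d ≤ π)
    (hcη : φ - c ≤ π * η) (hdη : d - φ ≤ π * η) :
    |sin φ * ∫ θ in c..d, (g θ - g φ) / (cos θ - cos φ)| ≤ 2 * C * π * η ^ α / α := by
  obtain ⟨h1, h2⟩ := intervalIntegrable_abs_sub_div_pi_rpow (α := α) hα hc hd
  rw [← intervalIntegral.integral_const_mul, ← Real.norm_eq_abs]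
  refine (intervalIntegral.norm_integral_le_of_norm_le (hc.trans hd)
    (g := fun θ => C * (|φ - θ| / π) ^ (α - 1)) ?_ ((h1.trans h2).const_mul C)).trans ?_
  · filter_upwards [Measure.ae_ne volume φ] with θ hθ hmem
    exact abs_sin_mul_slope_cos_le hφ hα hα1 hC hg
      ⟨hc0.trans hmem.1.le, hmem.2.trans hdπ⟩ hθ
  · rw [intervalIntegral.integral_const_mul, integral_abs_sub_div_pi_rpow hα hc hd]
    have hp := pi_pos
    have e1 : (φ - c) / π ≤ η := by rw [div_le_iff₀' hp]; exact hcη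
    have e2 : (d - φ) / π ≤ η := by rw [div_le_iff₀' hp]; exact hdη
    have f1 : 0 ≤ (φ - c) / π := div_nonneg (by linarith) hp.le
    have f2 : 0 ≤ (d - φ) / π := div_nonneg (by linarith) hp.le
    calc C * (π * ((φ - c) / π) ^ α / α + π * ((d - φ) / π) ^ α / α)
        ≤ C * (π * η ^ α / α + π * η ^ α / α) := by gcongr
      _ = _ := by ring

theorem abs_sin_mul_integral_slope_cos_le (hφ : φ ∈ Set.Ioo 0 π) (hα : 0 < α) (hα1 : α ≤ 1)
    (hC : 0 ≤ C) (hg : ∀ θ ∈ Set.Icc 0 π, |g θ - g φ| ≤ C * |cos θ - cos φ| ^ α)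
    (hgc : ContinuousOn g (Set.Icc 0 π)) {M : ℝ} (hM : ∀ θ ∈ Set.Icc 0 π, |g θ| ≤ M)
    {η : ℝ} (hη : 0 < η) (hη1 : η ≤ 1) :
    |sin φ * ∫ θ in (0 : ℝ)..π, (g θ - g φ) / (cos θ - cos φ)| ≤
      2 * M * (- log η) + 2 * C * π * η ^ α / α := by
  have hp := pi_pos
  have hπη : 0 < π * η := by positivity
  have hs : sin φ ≠ 0 := (sin_pos_of_pos_of_lt_pi hφ.1 hφ.2).ne'
  have hlog : 0 ≤ -log η := by linarith [log_nonpos hη.le hη1]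
  have hφI : φ ∈ Set.Icc 0 π := ⟨hφ.1.le, hφ.2.le⟩
  set Λ := cosKernelPrimitive φ with hΛ
  obtain ⟨a, ha0, haφ, haη, hΛa0, hΛa⟩ : ∃ a, 0 ≤ a ∧ a < φ ∧ φ - a ≤ π * η ∧
      0 ≤ Λ a ∧ Λ a ≤ -log η := by
    rcases le_or_gt φ (π * η) with h | h
    · refine ⟨0, le_rfl, hφ.1, by linarith, ?_, ?_⟩ <;> rw [hΛ, cosKernelPrimitive_zero]
      exact hlog
    · have hmem : φ - π * η ∈ Set.Icc 0 π := ⟨by linarith, by linarith [hφ.2]⟩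
      refine ⟨φ - π * η, hmem.1, by linarith, by linarith, ?_,
        cosKernelPrimitive_le hφ hmem hη (by rw [sub_sub_cancel]; exact le_abs_self _)⟩
      have := integral_cosKernel hφ hmem.1 (Set.Icc_subset_Icc le_rfl hmem.2)
        (fun h' => by linarith [h'.2])
      rw [cosKernelPrimitive_zero, sub_zero] at this
      rw [hΛ, ← this]
      refine intervalIntegral.integral_nonneg hmem.1 fun θ hθ => ?_
      exact div_nonneg (sin_nonneg_of_nonneg_of_le_pi hφ.1.le hφ.2.le)
        (sub_nonneg.2 (cos_le_cos_of_nonneg_of_le_pi hθ.1 hφ.2.le (by linarith [hθ.2])))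
  obtain ⟨b, hbπ, hφb, hbη, hΛb0, hΛb⟩ : ∃ b, b ≤ π ∧ φ < b ∧ b - φ ≤ π * η ∧
      0 ≤ Λ b ∧ Λ b ≤ -log η := by
    rcases le_or_gt π (φ + π * η) with h | h
    · refine ⟨π, le_rfl, hφ.2, by linarith, ?_, ?_⟩ <;> rw [hΛ, cosKernelPrimitive_pi]
      exact hlog
    · have hmem : φ + π * η ∈ Set.Icc 0 π := ⟨by linarith [hφ.1], h.le⟩
      refine ⟨φ + π * η, hmem.2, by linarith, by linarith, ?_,
        cosKernelPrimitive_le hφ hmem hη (by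
          rw [sub_add_cancel_left, abs_neg]; exact le_abs_self _)⟩
      have := integral_cosKernel hφ hmem.2 (Set.Icc_subset_Icc hmem.1 le_rfl)
        (fun h' => by linarith [h'.1])
      rw [cosKernelPrimitive_pi, zero_sub] at this
      rw [hΛ, ← neg_neg (cosKernelPrimitive φ _), ← this, ← intervalIntegral.integral_neg]
      refine intervalIntegral.integral_nonneg hmem.2 fun θ hθ => neg_nonneg.2 ?_
      exact div_nonpos_of_nonneg_of_nonpos (sin_nonneg_of_nonneg_of_le_pi hφ.1.le hφ.2.le)
        (sub_nonpos.2 (cos_le_cos_of_nonneg_of_le_pi hφ.1.le hθ.2 (by linarith [hθ.1])))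
  have hint := intervalIntegrable_slope_cos hφ hα hα1 hC hg hgc
  have hI : ∀ c d, 0 ≤ c → c ≤ d → d ≤ π →
      IntervalIntegrable (fun θ => (g θ - g φ) / (cos θ - cos φ)) volume c d := by
    intro c d hc hcd hd
    refine hint.mono_set ?_
    rw [Set.uIcc_of_le hcd, Set.uIcc_of_le hp.le]
    exact Set.Icc_subset_Icc hc hd
  have hsa : Set.Icc 0 a ⊆ Set.Icc 0 π := Set.Icc_subset_Icc le_rfl (by linarith)
  have hsb : Set.Icc b π ⊆ Set.Icc 0 π := Set.Icc_subset_Icc (by linarith [hφ.1]) le_rfl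
  have hma : φ ∉ Set.Icc 0 a := fun h => by linarith [h.2]
  have hmb : φ ∉ Set.Icc b π := fun h => by linarith [h.1]
  have hsplit : ∫ θ in (0 : ℝ)..π, (g θ - g φ) / (cos θ - cos φ) =
      (∫ θ in (0 : ℝ)..a, (g θ - g φ) / (cos θ - cos φ)) +
      (∫ θ in a..b, (g θ - g φ) / (cos θ - cos φ)) +
      ∫ θ in b..π, (g θ - g φ) / (cos θ - cos φ) := by
    rw [intervalIntegral.integral_add_adjacent_intervals (hI 0 a le_rfl ha0 (by linarith))
      (hI a b ha0 (by linarith) hbπ),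
      intervalIntegral.integral_add_adjacent_intervals (hI 0 b le_rfl (by linarith) hbπ)
      (hI b π (by linarith) hbπ le_rfl)]
  have ea := integral_div_cos_sub_cos hφ ha0 hsa hma hgc
  have eb := integral_div_cos_sub_cos hφ hbπ hsb hmb hgc
  have ba := abs_integral_div_cos_sub_cos_le hφ ha0 hsa hma hM
  have bb := abs_integral_div_cos_sub_cos_le hφ hbπ hsb hmb hM
  rw [← hΛ, hΛ, cosKernelPrimitive_zero, sub_zero, ← hΛ] at ea ba
  rw [← hΛ, hΛ, cosKernelPrimitive_pi, zero_sub, ← hΛ] at eb bb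
  rw [abs_neg, abs_of_nonneg hΛb0] at bb
  rw [abs_of_nonneg hΛa0] at ba
  have bn := abs_sin_mul_integral_slope_cos_near_le hφ hα hα1 hC hg ha0 haφ.le hφb.le hbπ haη hbη
  have hM0 : 0 ≤ M := (abs_nonneg _).trans (hM φ hφI)
  have hmid : |g φ * (Λ a - Λ b)| ≤ M * |Λ a - Λ b| := by
    rw [abs_mul]; exact mul_le_mul_of_nonneg_right (hM φ hφI) (abs_nonneg _)
  have hmax : Λ a + Λ b + |Λ a - Λ b| ≤ 2 * -log η := by
    rcases le_total (Λ a) (Λ b) with h | h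
    · rw [abs_of_nonpos (by linarith)]; linarith
    · rw [abs_of_nonneg (by linarith)]; linarith
  have key : sin φ * ∫ θ in (0 : ℝ)..π, (g θ - g φ) / (cos θ - cos φ) =
      sin φ * (∫ θ in (0 : ℝ)..a, g θ / (cos θ - cos φ)) +
      sin φ * (∫ θ in b..π, g θ / (cos θ - cos φ)) - g φ * (Λ a - Λ b) +
      sin φ * ∫ θ in a..b, (g θ - g φ) / (cos θ - cos φ) := by
    rw [hsplit, ea, eb]; field_simp; ring
  rw [key]
  have hfar := mul_le_mul_of_nonneg_left hmax hM0
  rw [abs_le] at ba bb bn hmid ⊢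
  constructor <;> linarith [ba.1, ba.2, bb.1, bb.2, bn.1, bn.2, hmid.1, hmid.2]

end Holder

theorem image_cos_Ioo {c d : ℝ} (hc : 0 ≤ c) (hcd : c ≤ d) (hd : d ≤ π) :
    cos '' Set.Ioo c d = Set.Ioo (cos d) (cos c) := by
  ext u
  constructor
  · rintro ⟨θ, ⟨h1, h2⟩, rfl⟩
    exact ⟨cos_lt_cos_of_nonneg_of_le_pi (hc.trans h1.le) hd h2,
      cos_lt_cos_of_nonneg_of_le_pi hc (h2.le.trans hd) h1⟩
  · rintro ⟨h1, h2⟩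
    have hu := cos_arccos ((neg_one_le_cos d).trans h1.le) (h2.le.trans (cos_le_one c))
    refine ⟨arccos u, ⟨?_, ?_⟩, hu⟩
    · by_contra! h
      linarith [cos_le_cos_of_nonneg_of_le_pi (arccos_nonneg u) (hcd.trans hd) h]
    · by_contra! h
      linarith [cos_le_cos_of_nonneg_of_le_pi (hc.trans hcd) (arccos_le_pi u) h]

theorem integral_div_sqrt_one_sub_sq {c d : ℝ} (hc : 0 ≤ c) (hcd : c ≤ d) (hd : d ≤ π)
    (F : ℝ → ℝ) :
    ∫ u in cos d..cos c, F u / √(1 - u ^ 2) = ∫ θ in c..d, F (cos θ) := by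
  rw [intervalIntegral.integral_of_le (cos_le_cos_of_nonneg_of_le_pi hc hd hcd),
    intervalIntegral.integral_of_le hcd, integral_Ioc_eq_integral_Ioo,
    integral_Ioc_eq_integral_Ioo, ← image_cos_Ioo hc hcd hd,
    integral_image_eq_integral_abs_deriv_smul measurableSet_Ioo
      (fun θ _ => (hasDerivAt_cos θ).hasDerivWithinAt)
      (injOn_cos.mono (Set.Ioo_subset_Icc_self.trans (Set.Icc_subset_Icc hc hd)))]
  refine setIntegral_congr_fun measurableSet_Ioo fun θ hθ => ?_
  have hs : 0 < sin θ := sin_pos_of_pos_of_lt_pi (hc.trans_lt hθ.1) (hθ.2.trans_le hd)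
  have e : √(1 - cos θ ^ 2) = sin θ := by
    rw [← sin_sq, sqrt_sq hs.le]
  simp only [smul_eq_mul, e, abs_neg, abs_of_pos hs]
  field_simp

theorem cosKernelPrimitive_eq {φ θ : ℝ} (hφ : φ ∈ Set.Ioo 0 π) (hθ : θ ∈ Set.Icc 0 π)
    (hne : θ ≠ φ) :
    cosKernelPrimitive φ θ = 2 * log (sin ((φ + θ) / 2)) - log (|cos θ - cos φ| / 2) := by
  have h1 := (sin_half_add_pos hφ hθ).ne'
  have h2 := sin_half_sub_ne_zero hφ hθ hne
  have e : |cos θ - cos φ| / 2 = |sin ((φ + θ) / 2) * sin ((φ - θ) / 2)| := by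
    rw [cos_sub_cos_eq_two_mul, mul_assoc, abs_mul, abs_of_pos (two_pos : (0 : ℝ) < 2)]
    field_simp
  rw [e, log_abs, log_mul h1 h2, cosKernelPrimitive]
  ring

theorem arccos_mem_Ioo {x : ℝ} (hx : x ∈ Set.Ioo (-1 : ℝ) 1) : arccos x ∈ Set.Ioo 0 π := by
  refine ⟨arccos_pos.2 hx.2, lt_of_le_of_ne (arccos_le_pi x) fun h => ?_⟩
  have := cos_arccos hx.1.le hx.2.le
  rw [h, cos_pi] at this
  linarith [hx.1]

theorem tendsto_principalValue {r : ℝ → ℝ} {C α x : ℝ} (hx : x ∈ Set.Ioo (-1 : ℝ) 1) (hα : 0 < α)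
    (hα1 : α ≤ 1) (hC : 0 ≤ C)
    (hr : ∀ u ∈ Set.Icc (-1 : ℝ) 1, |r u - r x| ≤ C * |u - x| ^ α)
    (hrc : ContinuousOn r (Set.Icc (-1) 1)) :
    Tendsto (fun ε : ℝ =>
      (∫ u in (-1 : ℝ)..(x - ε), r u / (√(1 - u ^ 2) * (u - x))) +
        ∫ u in (x + ε)..(1 : ℝ), r u / (√(1 - u ^ 2) * (u - x)))
      (𝓝[>] (0 : ℝ)) (𝓝 (∫ θ in (0 : ℝ)..π, (r (cos θ) - r x) / (cos θ - x))) := by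
  set φ := arccos x with hφdef
  have hφ : φ ∈ Set.Ioo 0 π := arccos_mem_Ioo hx
  have hcφ : cos φ = x := cos_arccos hx.1.le hx.2.le
  have hmaps : Set.MapsTo cos (Set.Icc 0 π) (Set.Icc (-1) 1) := fun θ _ => cos_mem_Icc θ
  have hgc : ContinuousOn (fun θ => r (cos θ)) (Set.Icc 0 π) :=
    hrc.comp continuous_cos.continuousOn hmaps
  have hg : ∀ θ ∈ Set.Icc 0 π, |r (cos θ) - r (cos φ)| ≤ C * |cos θ - cos φ| ^ α := fun θ hθ => by
    rw [hcφ]; exact hr _ (hmaps hθ)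
  have hp := pi_pos
  have hint := intervalIntegrable_slope_cos (g := fun θ => r (cos θ)) hφ hα hα1 hC hg hgc
  simp only [hcφ] at hint
  set D : ℝ → ℝ := fun θ => (r (cos θ) - r x) / (cos θ - x) with hD
  have hI : ∀ d ∈ Set.Icc 0 π, IntervalIntegrable D volume 0 d := by
    intro d hd
    refine hint.mono_set ?_
    rw [Set.uIcc_of_le hd.1, Set.uIcc_of_le hp.le]
    exact Set.Icc_subset_Icc le_rfl hd.2
  have hprim : ContinuousAt (fun y => ∫ θ in (0 : ℝ)..y, D θ) φ := by
    have := intervalIntegral.continuousOn_primitive_interval (μ := volume) (f := D) (a := 0) (b := π)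
      (by rw [Set.uIcc_of_le hp.le]; exact (intervalIntegrable_iff_integrableOn_Icc_of_le hp.le).1 hint)
    rw [Set.uIcc_of_le hp.le] at this
    exact this.continuousAt (Icc_mem_nhds hφ.1 hφ.2)
  have hlog : ContinuousAt (fun y => log (sin ((φ + y) / 2))) φ := by
    refine ContinuousAt.log (by fun_prop) ?_
    exact (sin_half_add_pos hφ ⟨hφ.1.le, hφ.2.le⟩).ne'
  have ha : Tendsto (fun ε : ℝ => arccos (x + ε)) (𝓝[>] 0) (𝓝 φ) := by
    have : Continuous fun ε : ℝ => arccos (x + ε) := continuous_arccos.comp (by fun_prop)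
    simpa using (this.tendsto 0).mono_left nhdsWithin_le_nhds
  have hb : Tendsto (fun ε : ℝ => arccos (x - ε)) (𝓝[>] 0) (𝓝 φ) := by
    have : Continuous fun ε : ℝ => arccos (x - ε) := continuous_arccos.comp (by fun_prop)
    simpa using (this.tendsto 0).mono_left nhdsWithin_le_nhds
  have hlim := ((((hprim.tendsto.comp ha).sub (hprim.tendsto.comp hb)).add_const
    (∫ θ in (0 : ℝ)..π, D θ))).add
    (((hlog.tendsto.comp ha).sub (hlog.tendsto.comp hb)).const_mul (2 * (r x / sin φ)))
  simp only [sub_self, zero_add, mul_zero, add_zero] at hlim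
  refine hlim.congr' ?_
  have hδ : 0 < min (1 - x) (1 + x) := lt_min (by linarith [hx.2]) (by linarith [hx.1])
  filter_upwards [Ioo_mem_nhdsGT hδ] with ε hε
  have hε0 := hε.1
  have hε1 : ε < 1 - x := hε.2.trans_le (min_le_left _ _)
  have hε2 : ε < 1 + x := hε.2.trans_le (min_le_right _ _)
  simp only [Function.comp_apply]
  set a := arccos (x + ε) with had
  set b := arccos (x - ε) with hbd
  have hca : cos a = x + ε := cos_arccos (by linarith) (by linarith)
  have hcb : cos b = x - ε := cos_arccos (by linarith) (by linarith)
  have haI : a ∈ Set.Icc 0 π := ⟨arccos_nonneg _, arccos_le_pi _⟩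
  have hbI : b ∈ Set.Icc 0 π := ⟨arccos_nonneg _, arccos_le_pi _⟩
  have haφ : a < φ := arccos_lt_arccos hx.1.le (by linarith) (by linarith)
  have hφb : φ < b := arccos_lt_arccos (by linarith) (by linarith) hx.2.le
  have hsa : Set.Icc 0 a ⊆ Set.Icc 0 π := Set.Icc_subset_Icc le_rfl haI.2
  have hsb : Set.Icc b π ⊆ Set.Icc 0 π := Set.Icc_subset_Icc hbI.1 le_rfl
  have hma : φ ∉ Set.Icc 0 a := fun h => by linarith [h.2]
  have hmb : φ ∉ Set.Icc b π := fun h => by linarith [h.1]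
  have ea := integral_div_cos_sub_cos (g := fun θ => r (cos θ)) hφ haI.1 hsa hma hgc
  have eb := integral_div_cos_sub_cos (g := fun θ => r (cos θ)) hφ hbI.2 hsb hmb hgc
  rw [cosKernelPrimitive_zero, cosKernelPrimitive_eq hφ haI haφ.ne] at ea
  rw [cosKernelPrimitive_pi, cosKernelPrimitive_eq hφ hbI hφb.ne'] at eb
  have va := integral_div_sqrt_one_sub_sq le_rfl haI.1 haI.2 fun u => r u / (u - x)
  have vb := integral_div_sqrt_one_sub_sq hbI.1 hbI.2 le_rfl fun u => r u / (u - x)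
  simp only [hcφ, hca, add_sub_cancel_left, abs_of_pos hε0] at ea
  simp only [hcφ, hcb, sub_sub_cancel_left, abs_neg, abs_of_pos hε0] at eb
  rw [cos_zero, hca, ea] at va
  rw [cos_pi, hcb, eb] at vb
  simp only [div_div, mul_comm _ √(_)] at va vb
  have hsplit := intervalIntegral.integral_add_adjacent_intervals (hI b hbI)
    ((hI b hbI).symm.trans hint)
  rw [va, vb, ← hsplit]
  ring

theorem continuousOn_of_holder {r : ℝ → ℝ} {C α : ℝ} {s : Set ℝ} (hα : 0 < α)
    (hr : ∀ u ∈ s, ∀ v ∈ s, |r u - r v| ≤ C * |u - v| ^ α) : ContinuousOn r s := by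
  intro v hv
  rw [ContinuousWithinAt, tendsto_iff_norm_sub_tendsto_zero]
  have h0 : Tendsto (fun u => C * |u - v| ^ α) (𝓝[s] v) (𝓝 0) := by
    have : Continuous fun u => C * |u - v| ^ α :=
      continuous_const.mul ((by fun_prop : Continuous fun u => |u - v|).rpow_const
        fun _ => Or.inr hα.le)
    simpa [zero_rpow hα.ne'] using (this.tendsto v).mono_left nhdsWithin_le_nhds
  refine squeeze_zero' (Eventually.of_forall fun _ => norm_nonneg _) ?_ h0
  filter_upwards [self_mem_nhdsWithin] with u hu
  exact hr u hu v hv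

theorem pi_mul_two_rpow_cube_le {α n : ℝ} (hα : 0 < α) (hα1 : α ≤ 1) (hn : 3 ≤ n) :
    π * ((2 : ℝ) ^ α) ^ 3 ≤ 4 * (2 * α + 1) * n ^ α := by
  have h1 : ((2 : ℝ) ^ α) ^ 3 = (1 + 5 / 3 : ℝ) ^ α * 3 ^ α := by
    rw [← mul_rpow (by norm_num) (by norm_num), ← rpow_natCast, ← rpow_mul (by norm_num),
      mul_comm α, rpow_mul (by norm_num)]
    norm_num
  have h2 : (1 + 5 / 3 : ℝ) ^ α ≤ 1 + α * (5 / 3) :=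
    rpow_one_add_le_one_add_mul_self (by norm_num) hα.le hα1
  have h3 : (3 : ℝ) ^ α ≤ n ^ α := by gcongr
  have h4 : π * (1 + α * (5 / 3)) ≤ 4 * (2 * α + 1) := by
    nlinarith [pi_lt_d2, pi_pos]
  calc π * ((2 : ℝ) ^ α) ^ 3 ≤ π * ((1 + α * (5 / 3)) * n ^ α) := by rw [h1]; gcongr
    _ = π * (1 + α * (5 / 3)) * n ^ α := by ring
    _ ≤ _ := by gcongr

theorem quadrature_bound_le {α γ K n : ℝ} (hα : 0 < α) (hα1 : α ≤ 1) (hγ : 0 < γ) (hK : 0 < K)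
    (hn : 3 ≤ n) :
    (2 * (K * (γ / n / 2) ^ α) * (-log (1 / n ^ 2)) + 2 * (2 * K) * π * (1 / n ^ 2) ^ α / α) / π ≤
      (2 ^ (2 - α) * γ ^ α * K / π) *
        (1 + (2 + 1 / α) * 2 ^ (2 - 2 * α) / (γ ^ α * log n)) * log n / n ^ α := by
  have hn0 : 0 < n := by linarith
  have hp := pi_pos
  have hL : 0 < log n := log_pos (by linarith)
  have key := pi_mul_two_rpow_cube_le hα hα1 hn
  have hA : (0 : ℝ) < 2 ^ α := by positivity
  have hB : 0 < n ^ α := by positivity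
  have hG : 0 < γ ^ α := by positivity
  have e1 : (2 : ℝ) ^ (2 - α) = 4 / 2 ^ α := by
    rw [rpow_sub (by norm_num)]; norm_num
  have e2 : (2 : ℝ) ^ (2 - 2 * α) = 4 / (2 ^ α) ^ 2 := by
    rw [rpow_sub (by norm_num), mul_comm, rpow_mul (by norm_num)]; norm_num
  have e3 : (γ / n / 2) ^ α = γ ^ α / n ^ α / 2 ^ α := by
    rw [div_rpow (by positivity) (by norm_num), div_rpow hγ.le hn0.le]
  have e4 : (1 / n ^ 2) ^ α = 1 / (n ^ α) ^ 2 := by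
    rw [div_rpow zero_le_one (by positivity), one_rpow, ← rpow_natCast n 2, ← rpow_mul hn0.le,
      mul_comm, rpow_mul hn0.le, rpow_natCast]
  have e5 : -log (1 / n ^ 2) = 2 * log n := by
    rw [one_div, log_inv, neg_neg, log_pow]; norm_num
  rw [e1, e2, e3, e4, e5]
  generalize (2 : ℝ) ^ α = A at *
  generalize n ^ α = B at *
  generalize γ ^ α = G at *
  generalize log n = L at *
  rw [← sub_nonneg]
  have : 4 / A * G * K / π * (1 + (2 + 1 / α) * (4 / A ^ 2) / (G * L)) * L / B -
      (2 * (K * (G / B / A)) * (2 * L) + 2 * (2 * K) * π * (1 / B ^ 2) / α) / π =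
      4 * K / (π * α * A ^ 3 * B ^ 2) * (4 * (2 * α + 1) * B - π * A ^ 3) := by
    field_simp
    ring
  rw [this]
  exact mul_nonneg (by positivity) (sub_nonneg.2 key)

theorem quadrature_error_Holder_table3
    (N : ℕ) (hN : 3 ≤ N)
    (t : ℕ → ℝ) (ht0 : t 0 = -1) (htN : t N = 1)
    (hmono : ∀ k, k < N → t k < t (k + 1))
    (γ : ℝ) (hγ : 0 < γ)
    (hstep : ∀ k, k < N → t (k + 1) - t k ≤ γ / N)
    (f S : ℝ → ℝ) (K α : ℝ) (hα : 0 < α) (hα1 : α ≤ 1) (hK : 0 < K)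
    (hf : ∀ u ∈ Set.Icc (-1 : ℝ) 1, ∀ v ∈ Set.Icc (-1 : ℝ) 1,
      |f u - f v| ≤ K * |u - v| ^ α)
    (hS : ∀ k, k < N → ∀ u ∈ Set.Icc (t k) (t (k + 1)),
      S u = ((t (k + 1) - u) * f (t k) + (u - t k) * f (t (k + 1))) / (t (k + 1) - t k))
    (x : ℝ) (hx : x ∈ Set.Ioo (-1 : ℝ) 1) :
    ∃ I : ℝ,
      Tendsto (fun ε : ℝ =>
          (∫ u in (-1 : ℝ)..(x - ε), (f u - S u) / (Real.sqrt (1 - u ^ 2) * (u - x))) +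
          ∫ u in (x + ε)..(1 : ℝ), (f u - S u) / (Real.sqrt (1 - u ^ 2) * (u - x)))
        (𝓝[>] (0 : ℝ)) (𝓝 I) ∧
      |Real.sqrt (1 - x ^ 2) / π * I| ≤
        (2 ^ (2 - α) * γ ^ α * K / π) *
          (1 + (2 + 1 / α) * 2 ^ (2 - 2 * α) / (γ ^ α * Real.log N)) *
          Real.log N / (N : ℝ) ^ α := by
  have hN0 : 0 < N := by omega
  have hn : (3 : ℝ) ≤ N := by exact_mod_cast hN
  rw [← ht0, ← htN] at hf
  have hSH : ∀ u ∈ Set.Icc (-1 : ℝ) 1, ∀ v ∈ Set.Icc (-1 : ℝ) 1,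
      |S u - S v| ≤ K * |u - v| ^ α := by
    intro u hu v hv
    rw [← ht0, ← htN] at hu hv
    exact linear_spline_holder hN0 hmono hα hα1 hK.le hf hS hu hv
  have hM : ∀ u ∈ Set.Icc (-1 : ℝ) 1, |f u - S u| ≤ K * (γ / N / 2) ^ α := by
    intro u hu
    rw [← ht0, ← htN] at hu
    exact abs_sub_linear_spline_le hN0 hmono hα hα1 hK.le hstep hf hS hu
  rw [ht0, htN] at hf
  have hr : ∀ u ∈ Set.Icc (-1 : ℝ) 1, ∀ v ∈ Set.Icc (-1 : ℝ) 1,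
      |(f u - S u) - (f v - S v)| ≤ 2 * K * |u - v| ^ α := by
    intro u hu v hv
    have h1 := hf u hu v hv
    have h2 := hSH u hu v hv
    rw [abs_le] at h1 h2 ⊢
    constructor <;> linarith [h1.1, h1.2, h2.1, h2.2]
  have hrc := continuousOn_of_holder (r := fun u => f u - S u) hα hr
  have hxI : x ∈ Set.Icc (-1 : ℝ) 1 := ⟨hx.1.le, hx.2.le⟩
  refine ⟨_, tendsto_principalValue (r := fun u => f u - S u) hx hα hα1 (by positivity)
    (fun u hu => hr u hu x hxI) hrc, ?_⟩
  have hcφ : cos (arccos x) = x := cos_arccos hx.1.le hx.2.le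
  have hη1 : 1 / (N : ℝ) ^ 2 ≤ 1 := by
    rw [div_le_one (by positivity)]; nlinarith
  have hmain := abs_sin_mul_integral_slope_cos_le (g := fun θ => f (cos θ) - S (cos θ))
    (C := 2 * K) (M := K * (γ / N / 2) ^ α) (arccos_mem_Ioo hx) hα hα1 (by positivity)
    (fun θ _ => hr _ (cos_mem_Icc θ) _ (cos_mem_Icc _))
    (hrc.comp continuous_cos.continuousOn fun θ _ => cos_mem_Icc θ)
    (fun θ _ => hM _ (cos_mem_Icc θ)) (by positivity : 0 < 1 / (N : ℝ) ^ 2) hη1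
  simp only [hcφ, sin_arccos] at hmain
  refine le_trans ?_ (quadrature_bound_le hα hα1 hγ hK hn)
  rw [div_mul_eq_mul_div, abs_div, abs_of_pos pi_pos]
  exact div_le_div_of_nonneg_right hmain pi_pos.le
end
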